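/- arXiv:2601.19797 — 2 statements merged into one kernel-verified Lean document; each statement's English description precedes it below -/
import Mathlib

section
/- Let 1 < p < ∞, let Ω ⊂ ℝ^n be open and bounded, and let ρ satisfy (H0)–(H4) and have compact support. Then there exists a constant c > 0 such that for every u ∈ C_c^∞(Ω) (extended by zero to ℝ^n), ‖u‖_{L^p(Ω)} ≤ c ‖D_ρ u‖_{L^p(ℝ^n; ℝ^n)}. (Poincaré inequality for nonlocal gradients with general kernels.) -/
open MeasureTheory Metric Set Matrix
open scoped ENNReal InnerProductSpace

noncomputable section

/-- Points of `ℝ^n` with the Euclidean norm. -/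
abbrev Eu (n : ℕ) := EuclideanSpace ℝ (Fin n)

/-- Hypothesis (H0): `ρ` is a nonnegative radial kernel (with radial representation `ρb`),
locally integrable, with `∫ min{1,|x|⁻¹} ρ(x) dx < ∞`, and bounded below away from zero
on a closed ball of some radius `ε > 0`. -/
def IsKernelH0 (n : ℕ) (ρ : Eu n → ℝ) (ρb : ℝ → ℝ) (ε : ℝ) : Prop :=
  (∀ x, 0 ≤ ρ x) ∧
  (∀ x : Eu n, x ≠ 0 → ρ x = ρb ‖x‖) ∧
  LocallyIntegrable ρ volume ∧
  Integrable (fun x : Eu n => min 1 ‖x‖⁻¹ * ρ x) volume ∧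
  0 < ε ∧
  ∃ c > (0 : ℝ), ∀ x ∈ closedBall (0 : Eu n) ε, x ≠ 0 → c ≤ ρ x

/-- The auxiliary function `f_ρ(r) = r^(n-2) ρ̄(r)`. -/
def fRho (n : ℕ) (ρb : ℝ → ℝ) (r : ℝ) : ℝ := r ^ ((n : ℝ) - 2) * ρb r

/-- Hypothesis (H1): `f_ρ` and `r ↦ r^ν f_ρ(r)` are decreasing on `(0, ε)` for some `ν > 0`. -/
def IsKernelH1 (n : ℕ) (ρb : ℝ → ℝ) (ε : ℝ) : Prop :=
  ∃ ν > (0 : ℝ), AntitoneOn (fRho n ρb) (Ioo 0 ε) ∧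
    AntitoneOn (fun r => r ^ ν * fRho n ρb r) (Ioo 0 ε)

/-- Hypothesis (H2): `f_ρ` is smooth away from the origin and its derivatives satisfy
`|f_ρ^{(k)}(r)| ≤ C(k) r^(-k) f_ρ(r)` on `(0, ε)`. -/
def IsKernelH2 (n : ℕ) (ρb : ℝ → ℝ) (ε : ℝ) : Prop :=
  ContDiffOn ℝ (⊤ : ℕ∞) (fRho n ρb) (Ioi 0) ∧
  ∀ k : ℕ, 0 < k → ∃ C > (0 : ℝ), ∀ r ∈ Ioo (0 : ℝ) ε,
    |iteratedDerivWithin k (fRho n ρb) (Ioi 0) r| ≤ C * r ^ (-(k : ℝ)) * fRho n ρb r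

/-- Hypothesis (H3): `r ↦ r^(n+s-1) ρ̄(r)` is almost decreasing on `(0, ε)` for some `s ∈ (0,1)`. -/
def IsKernelH3 (n : ℕ) (ρb : ℝ → ℝ) (ε : ℝ) : Prop :=
  ∃ s ∈ Ioo (0 : ℝ) 1, ∃ C > (0 : ℝ), ∀ r₁ ∈ Ioo (0 : ℝ) ε, ∀ r₂ ∈ Ioo (0 : ℝ) ε, r₁ ≤ r₂ →
    C * (r₂ ^ ((n : ℝ) + s - 1) * ρb r₂) ≤ r₁ ^ ((n : ℝ) + s - 1) * ρb r₁

/-- Hypothesis (H4): `r ↦ r^(n+t-1) ρ̄(r)` is almost increasing on `(0, ε)` for some `t ∈ (0,1)`. -/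
def IsKernelH4 (n : ℕ) (ρb : ℝ → ℝ) (ε : ℝ) : Prop :=
  ∃ t ∈ Ioo (0 : ℝ) 1, ∃ C > (0 : ℝ), ∀ r₁ ∈ Ioo (0 : ℝ) ε, ∀ r₂ ∈ Ioo (0 : ℝ) ε, r₁ ≤ r₂ →
    C * (r₁ ^ ((n : ℝ) + t - 1) * ρb r₁) ≤ r₂ ^ ((n : ℝ) + t - 1) * ρb r₂

variable {n : ℕ}

/-- Nonlocal gradient of a scalar field:
`D_ρ u(x) = ∫ ((u(x) - u(y))/|x-y|) ((x-y)/|x-y|) ρ(x-y) dy`. -/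
def nlGradS (ρ : Eu n → ℝ) (u : Eu n → ℝ) (x : Eu n) : Eu n :=
  ∫ y, ((u x - u y) * ρ (x - y) / ‖x - y‖ ^ 2) • (x - y)

/-- The (i,j) entry of the integrand of the nonlocal gradient of a vector field. -/
def nlGradMInt (ρ : Eu n → ℝ) (u : Eu n → Eu n) (x : Eu n) (i j : Fin n) : Eu n → ℝ :=
  fun y => (u x - u y) i * (x - y) j * ρ (x - y) / ‖x - y‖ ^ 2

/-- Nonlocal gradient of a vector field, as a matrix:
`D_ρ u(x) = ∫ ((u(x)-u(y))/|x-y|) ⊗ ((x-y)/|x-y|) ρ(x-y) dy`. -/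
def nlGradM (ρ : Eu n → ℝ) (u : Eu n → Eu n) (x : Eu n) : Matrix (Fin n) (Fin n) ℝ :=
  Matrix.of fun i j => ∫ y, nlGradMInt ρ u x i j y

/-- The integrand of the nonlocal divergence of a vector field. -/
def nlDivVInt (ρ : Eu n → ℝ) (u : Eu n → Eu n) (x : Eu n) : Eu n → ℝ :=
  fun y => ⟪u x - u y, x - y⟫_ℝ * ρ (x - y) / ‖x - y‖ ^ 2

/-- Nonlocal divergence of a vector field:
`div_ρ u(x) = ∫ ((u(x)-u(y))·(x-y)/|x-y|²) ρ(x-y) dy`. -/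
def nlDivV (ρ : Eu n → ℝ) (u : Eu n → Eu n) (x : Eu n) : ℝ :=
  ∫ y, nlDivVInt ρ u x y

/-- The i-th component of the integrand of the nonlocal divergence of a matrix field. -/
def nlDivMInt (ρ : Eu n → ℝ) (Φ : Eu n → Matrix (Fin n) (Fin n) ℝ) (x : Eu n) (i : Fin n) :
    Eu n → ℝ :=
  fun y => (∑ j, (Φ x i j - Φ y i j) * (x - y) j) * ρ (x - y) / ‖x - y‖ ^ 2

/-- Nonlocal divergence of a matrix field:
`div_ρ Φ(x) = ∫ ((Φ(x)-Φ(y))/|x-y|) ((x-y)/|x-y|) ρ(x-y) dy ∈ ℝ^n`. -/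
def nlDivM (ρ : Eu n → ℝ) (Φ : Eu n → Matrix (Fin n) (Fin n) ℝ) (x : Eu n) : Eu n :=
  (WithLp.equiv 2 (Fin n → ℝ)).symm fun i => ∫ y, nlDivMInt ρ Φ x i y

/-- Frobenius inner product `A : B = Σ_{ij} a_{ij} b_{ij}` of matrices. -/
def frobInner (A B : Matrix (Fin n) (Fin n) ℝ) : ℝ := ∑ i, ∑ j, A i j * B i j

/-- Symmetric part of a matrix, `M_sym = (M + Mᵀ)/2`. -/
def symPart (M : Matrix (Fin n) (Fin n) ℝ) : Matrix (Fin n) (Fin n) ℝ :=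
  (1 / 2 : ℝ) • (M + Mᵀ)

/-- The potential `Q_ρ(x) = ∫_{|x|}^∞ ρ̄(t)/t dt`. -/
def Qker (n : ℕ) (ρb : ℝ → ℝ) (x : Eu n) : ℝ := ∫ t in Ioi ‖x‖, ρb t / t

/-- Classical Jacobian matrix of a vector field, `(Du)_{ij} = ∂u_i/∂x_j`. -/
def jacobianM (u : Eu n → Eu n) (x : Eu n) : Matrix (Fin n) (Fin n) ℝ :=
  Matrix.of fun i j => fderiv ℝ (fun z => u z i) x (EuclideanSpace.single j 1)

/-- Rank-one matrix `a ⊗ b = (a_i b_j)`. -/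
def tensorP (a b : Eu n) : Matrix (Fin n) (Fin n) ℝ := Matrix.of fun i j => a i * b j

/-- Isotropic elasticity tensor `C[M] = 2μ M_sym + λ (tr M) I`. -/
def isoC (μ lam : ℝ) (M : Matrix (Fin n) (Fin n) ℝ) : Matrix (Fin n) (Fin n) ℝ :=
  (2 * μ) • symPart M + (lam * Matrix.trace M) • (1 : Matrix (Fin n) (Fin n) ℝ)

/-- Fourier transform `𝓕 f(ξ) = ∫ f(x) e^{-2πi x·ξ} dx` of a complex-valued function on ℝ^n. -/
def fInt (f : Eu n → ℂ) (ξ : Eu n) : ℂ :=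
  ∫ x, f x * Complex.exp (-(2 * Real.pi * (⟪x, ξ⟫_ℝ : ℝ) * Complex.I))

/-- The nonlocal Laplacian `(-Δ)_ρ v = -div_ρ (D_ρ v)` of a vector field. -/
def nlLap (ρ : Eu n → ℝ) (v : Eu n → Eu n) (x : Eu n) : Eu n :=
  -nlDivM ρ (fun z => nlGradM ρ v z) x

/-- The i-th component of the integrand of `K_{ρ,φ}(Φ)` from the nonlocal Leibniz rule. -/
def KtermInt (ρ : Eu n → ℝ) (φ : Eu n → ℝ) (Φ : Eu n → Matrix (Fin n) (Fin n) ℝ)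
    (x : Eu n) (i : Fin n) : Eu n → ℝ :=
  fun y => (φ x - φ y) * (∑ j, Φ y i j * (x - y) j) * ρ (x - y) / ‖x - y‖ ^ 2

/-- `K_{ρ,φ}(Φ)(x) = ∫ ((φ(x)-φ(y))/|x-y|) Φ(y) ((x-y)/|x-y|) ρ(x-y) dy`. -/
def Kterm (ρ : Eu n → ℝ) (φ : Eu n → ℝ) (Φ : Eu n → Matrix (Fin n) (Fin n) ℝ)
    (x : Eu n) : Eu n :=
  (WithLp.equiv 2 (Fin n → ℝ)).symm fun i => ∫ y, KtermInt ρ φ Φ x i y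

/-- Classical divergence of a vector field. -/
def divCl (w : Eu n → Eu n) (x : Eu n) : ℝ :=
  ∑ i, fderiv ℝ (fun z => w z i) x (EuclideanSpace.single i 1)

namespace NonlocalPoincare

open Filter Topology
open scoped Convolution

/-- The `L^p` norm of a function on `ℝ^n`, as a real number. -/
def pNorm {F : Type*} [Norm F] (p : ℝ) (f : Eu n → F) : ℝ := (∫ x, ‖f x‖ ^ p) ^ (1 / p)

/-- Convolution of two real-valued functions on `ℝ^n`. -/
def moll (k w : Eu n → ℝ) (x : Eu n) : ℝ := ∫ t, k t * w (x - t)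

section Norms

variable {F : Type*} [NormedAddCommGroup F]

theorem pNorm_nonneg (p : ℝ) (f : Eu n → F) : 0 ≤ pNorm p f :=
  Real.rpow_nonneg (integral_nonneg fun _ => Real.rpow_nonneg (norm_nonneg _) _) _

theorem pNorm_rpow {p : ℝ} (hp : 0 < p) (f : Eu n → F) : pNorm p f ^ p = ∫ x, ‖f x‖ ^ p := by
  have h : 0 ≤ ∫ x, ‖f x‖ ^ p :=
    integral_nonneg fun _ => Real.rpow_nonneg (norm_nonneg _) _
  rw [pNorm, ← Real.rpow_mul h, one_div_mul_cancel hp.ne', Real.rpow_one]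

theorem pNorm_norm (p : ℝ) (f : Eu n → F) : pNorm p (fun x => ‖f x‖) = pNorm p f := by
  simp [pNorm]

theorem integrable_norm_rpow {p : ℝ} (hp : 0 < p) {f : Eu n → F} (hf : Continuous f)
    (hc : HasCompactSupport f) : Integrable (fun x => ‖f x‖ ^ p) := by
  refine (hf.norm.rpow_const fun _ => Or.inr hp.le).integrable_of_hasCompactSupport ?_
  exact hc.comp_left (g := fun y : F => ‖y‖ ^ p) (by simp [hp.ne'])

theorem pNorm_mono {p : ℝ} (hp : 0 < p) {F' : Type*} [NormedAddCommGroup F'] {f : Eu n → F}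
    {g : Eu n → F'} (hg : Continuous g) (hgc : HasCompactSupport g)
    (h : ∀ x, ‖f x‖ ≤ ‖g x‖) : pNorm p f ≤ pNorm p g := by
  refine Real.rpow_le_rpow (integral_nonneg fun _ => Real.rpow_nonneg (norm_nonneg _) _) ?_
    (by positivity)
  refine integral_mono_of_nonneg (ae_of_all _ fun _ => Real.rpow_nonneg (norm_nonneg _) _)
    (integrable_norm_rpow hp hg hgc) (ae_of_all _ fun x => ?_)
  exact Real.rpow_le_rpow (norm_nonneg _) (h x) hp.le

theorem pNorm_translate (p : ℝ) (f : Eu n → F) (t : Eu n) :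
    pNorm p (fun x => f (x - t)) = pNorm p f := by
  unfold pNorm
  rw [integral_sub_right_eq_self (fun x => ‖f x‖ ^ p) t]

theorem eLpNorm_eq_pNorm {p : ℝ} (hp : 0 < p) {f : Eu n → F} (hf : Continuous f)
    (hc : HasCompactSupport f) :
    eLpNorm f (ENNReal.ofReal p) volume = ENNReal.ofReal (pNorm p f) := by
  have := (hf.memLp_of_hasCompactSupport (μ := volume) (p := ENNReal.ofReal p)
    hc).eLpNorm_eq_integral_rpow_norm (by simpa using hp) ENNReal.ofReal_ne_top
  rw [this, ENNReal.toReal_ofReal hp.le, pNorm, one_div]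

theorem integral_mul_le_pNorm {p q : ℝ} (hpq : p.HolderConjugate q) {F' : Type*}
    [NormedAddCommGroup F'] {f : Eu n → F} {g : Eu n → F'} (hf : Continuous f)
    (hfc : HasCompactSupport f) (hg : Continuous g) (hgc : HasCompactSupport g) :
    ∫ x, ‖f x‖ * ‖g x‖ ≤ pNorm p f * pNorm q g :=
  integral_mul_le_Lp_mul_Lq_of_nonneg hpq (ae_of_all _ fun _ => norm_nonneg _)
    (ae_of_all _ fun _ => norm_nonneg _)
    (hf.memLp_of_hasCompactSupport hfc).norm (hg.memLp_of_hasCompactSupport hgc).norm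

end Norms

theorem le_of_rpow_le {p N A : ℝ} (hN : 0 ≤ N) (hA : 0 ≤ A)
    (h : N ^ p ≤ N ^ (p - 1) * A) : N ≤ A := by
  rcases hN.eq_or_lt with rfl | hN
  · exact hA
  · have h1 : N ^ p = N ^ (p - 1) * N := by
      rw [← Real.rpow_add_one hN.ne']; simp
    rw [h1] at h
    exact le_of_mul_le_mul_left h (Real.rpow_pos_of_pos hN _)

theorem moll_eq_convolution (k w : Eu n → ℝ) :
    moll k w = (k ⋆[ContinuousLinearMap.mul ℝ ℝ, volume] w) := rfl

section Moll

variable {k w : Eu n → ℝ}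

theorem continuous_moll (hk : Continuous k) (hkc : HasCompactSupport k) (hw : Continuous w) :
    Continuous (moll k w) := by
  rw [moll_eq_convolution]
  exact hkc.continuous_convolution_left _ hk hw.locallyIntegrable

theorem hasCompactSupport_moll (hkc : HasCompactSupport k) (hwc : HasCompactSupport w) :
    HasCompactSupport (moll k w) := by
  rw [moll_eq_convolution]
  exact hkc.convolution _ hwc

theorem contDiff_moll (hk : ContDiff ℝ (⊤ : ℕ∞) k) (hkc : HasCompactSupport k)
    (hw : Continuous w) : ContDiff ℝ (⊤ : ℕ∞) (moll k w) := by
  rw [moll_eq_convolution]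
  exact hkc.contDiff_convolution_left _ hk hw.locallyIntegrable

theorem moll_nonneg (hk : ∀ x, 0 ≤ k x) (hw : ∀ x, 0 ≤ w x) (x : Eu n) : 0 ≤ moll k w x :=
  integral_nonneg fun _ => mul_nonneg (hk _) (hw _)

theorem moll_swap (k w : Eu n → ℝ) (x : Eu n) : moll k w x = ∫ y, k (x - y) * w y := by
  rw [moll, ← integral_sub_left_eq_self (fun t => k t * w (x - t)) volume x]
  simp

theorem integrable_conv (hk : Continuous k) (hkc : HasCompactSupport k) (hw : Continuous w)
    (x : Eu n) : Integrable (fun t => k t * w (x - t)) := by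
  refine Continuous.integrable_of_hasCompactSupport (by fun_prop) ?_
  exact hkc.mul_right

theorem integrable_trilinear {F : Eu n → ℝ} (hF : Continuous F) (hFc : HasCompactSupport F)
    (hk : Continuous k) (hkc : HasCompactSupport k) (hw : Continuous w) :
    Integrable (Function.uncurry fun x t => F x * (k t * w (x - t)))
      (volume.prod volume) := by
  refine Continuous.integrable_of_hasCompactSupport
    (f := Function.uncurry fun x t => F x * (k t * w (x - t))) ?_ ?_
  · unfold Function.uncurry
    fun_prop
  · refine HasCompactSupport.intro (hFc.isCompact.prod hkc.isCompact) ?_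
    rintro ⟨x, t⟩ h
    simp only [mem_prod, not_and_or] at h
    rcases h with h | h
    · simp [Function.uncurry, image_eq_zero_of_notMem_tsupport h]
    · simp [Function.uncurry, image_eq_zero_of_notMem_tsupport h]

/-- Fubini for the trilinear convolution form. -/
theorem integral_mul_moll {F : Eu n → ℝ} (hF : Continuous F) (hFc : HasCompactSupport F)
    (hk : Continuous k) (hkc : HasCompactSupport k) (hw : Continuous w) :
    ∫ x, F x * moll k w x = ∫ t, k t * ∫ x, F x * w (x - t) := by
  calc ∫ x, F x * moll k w x = ∫ x, ∫ t, F x * (k t * w (x - t)) := by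
        simp only [moll, ← integral_const_mul]
    _ = ∫ t, ∫ x, F x * (k t * w (x - t)) :=
        integral_integral_swap (integrable_trilinear hF hFc hk hkc hw)
    _ = _ := by
        congr 1; ext t
        rw [← integral_const_mul]
        congr 1; ext x; ring

theorem integrable_mul_correlation {F : Eu n → ℝ} (hF : Continuous F)
    (hFc : HasCompactSupport F) (hk : Continuous k) (hkc : HasCompactSupport k)
    (hw : Continuous w) : Integrable fun t => k t * ∫ x, F x * w (x - t) := by
  refine (integrable_trilinear hF hFc hk hkc hw).integral_prod_right.congr
    (ae_of_all _ fun t => ?_)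
  simp only [Function.uncurry, ← integral_const_mul]
  congr 1; ext x; ring

theorem correlation_le {p q : ℝ} (hpq : p.HolderConjugate q) {F : Eu n → ℝ}
    (hF : Continuous F) (hFc : HasCompactSupport F)
    (hw : Continuous w) (hwc : HasCompactSupport w) (t : Eu n) :
    ∫ x, F x * w (x - t) ≤ pNorm q F * pNorm p w := by
  have hwt : HasCompactSupport fun x => w (x - t) :=
    hwc.comp_homeomorph (Homeomorph.subRight t)
  have hwt' : Continuous fun x => w (x - t) := by fun_prop
  rw [← pNorm_translate p w t]
  refine le_trans (integral_mono ?_ ?_ fun x => ?_)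
    (integral_mul_le_pNorm hpq.symm hF hFc hwt' hwt)
  · exact (hF.mul hwt').integrable_of_hasCompactSupport hFc.mul_right
  · exact (hF.norm.mul hwt'.norm).integrable_of_hasCompactSupport hFc.norm.mul_right
  · rw [← norm_mul]
    exact Real.le_norm_self _

theorem integral_mul_moll_le {p q : ℝ} (hpq : p.HolderConjugate q) {F : Eu n → ℝ}
    (hF : Continuous F) (hFc : HasCompactSupport F)
    (hk : Continuous k) (hkc : HasCompactSupport k) (hk0 : ∀ x, 0 ≤ k x)
    (hw : Continuous w) (hwc : HasCompactSupport w) :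
    ∫ x, F x * moll k w x ≤ (∫ t, k t) * (pNorm q F * pNorm p w) := by
  rw [integral_mul_moll hF hFc hk hkc hw, ← integral_mul_const]
  refine integral_mono (integrable_mul_correlation hF hFc hk hkc hw)
    ((hk.integrable_of_hasCompactSupport hkc).mul_const _) fun t => ?_
  exact mul_le_mul_of_nonneg_left (correlation_le hpq hF hFc hw hwc t) (hk0 t)

end Moll

/-- The duality map `t ↦ |t|^(p-2) t`. -/
def dualMap (p t : ℝ) : ℝ := max t 0 ^ (p - 1) - max (-t) 0 ^ (p - 1)

section Dual

variable {p : ℝ}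

theorem continuous_dualMap (hp : 1 < p) : Continuous (dualMap p) := by
  unfold dualMap
  refine Continuous.sub ?_ ?_
  · exact Continuous.rpow_const (by fun_prop) fun _ => Or.inr (by linarith)
  · exact Continuous.rpow_const (by fun_prop) fun _ => Or.inr (by linarith)

theorem dualMap_of_nonneg (hp : 1 < p) {t : ℝ} (ht : 0 ≤ t) : dualMap p t = t ^ (p - 1) := by
  have : max (-t) 0 = 0 := max_eq_right (by linarith)
  rw [dualMap, this, max_eq_left ht, Real.zero_rpow (by linarith), sub_zero]

theorem dualMap_neg (t : ℝ) : dualMap p (-t) = -dualMap p t := by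
  simp [dualMap]

theorem dualMap_zero (hp : 1 < p) : dualMap p 0 = 0 := by
  rw [dualMap_of_nonneg hp le_rfl, Real.zero_rpow (by linarith)]

theorem norm_dualMap (hp : 1 < p) (t : ℝ) : ‖dualMap p t‖ = ‖t‖ ^ (p - 1) := by
  rcases le_total 0 t with h | h
  · rw [dualMap_of_nonneg hp h, Real.norm_of_nonneg h,
      Real.norm_of_nonneg (Real.rpow_nonneg h _)]
  · have h' : 0 ≤ -t := by linarith
    rw [← neg_neg t, dualMap_neg, norm_neg, norm_neg, dualMap_of_nonneg hp h',
      Real.norm_of_nonneg h', Real.norm_of_nonneg (Real.rpow_nonneg h' _)]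

theorem dualMap_mul_self (hp : 1 < p) (t : ℝ) : dualMap p t * t = ‖t‖ ^ p := by
  have key : ∀ t : ℝ, 0 ≤ t → dualMap p t * t = ‖t‖ ^ p := by
    intro t h
    rw [dualMap_of_nonneg hp h, Real.norm_of_nonneg h]
    rcases h.eq_or_lt with rfl | h
    · rw [mul_zero, Real.zero_rpow (by linarith)]
    · rw [← Real.rpow_add_one h.ne']; simp
  rcases le_total 0 t with h | h
  · exact key t h
  · have := key (-t) (by linarith)
    rwa [dualMap_neg, norm_neg, neg_mul_neg] at this

theorem pNorm_dualMap {q : ℝ} (hpq : p.HolderConjugate q) (v : Eu n → ℝ) :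
    pNorm q (fun x => dualMap p (v x)) = pNorm p v ^ (p - 1) := by
  have hp := hpq.lt
  have h : 0 ≤ ∫ x, ‖v x‖ ^ p :=
    integral_nonneg fun _ => Real.rpow_nonneg (norm_nonneg _) _
  have e : (p - 1) * q = p := by
    have := hpq.sub_one_mul_conj
    linarith
  simp only [pNorm, norm_dualMap hp]
  rw [← Real.rpow_mul h]
  have : ∀ x, (‖v x‖ ^ (p - 1)) ^ q = ‖v x‖ ^ p := fun x => by
    rw [← Real.rpow_mul (norm_nonneg _), e]
  simp only [this]
  congr 1
  have hq := hpq.symm.pos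
  have hp' := hpq.pos
  field_simp
  linarith

theorem hasCompactSupport_dualMap (hp : 1 < p) {v : Eu n → ℝ} (hv : HasCompactSupport v) :
    HasCompactSupport fun x => dualMap p (v x) :=
  hv.comp_left (g := dualMap p) (dualMap_zero hp)

theorem integral_dualMap_mul_self (hp : 1 < p) (v : Eu n → ℝ) :
    ∫ x, dualMap p (v x) * v x = pNorm p v ^ p := by
  simp only [dualMap_mul_self hp, pNorm_rpow (by linarith : (0 : ℝ) < p)]

end Dual

/-- Young's inequality for convolution with a nonnegative kernel. -/
theorem pNorm_moll_le {p q : ℝ} (hpq : p.HolderConjugate q) {k w : Eu n → ℝ}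
    (hk : Continuous k) (hkc : HasCompactSupport k) (hk0 : ∀ x, 0 ≤ k x)
    (hw : Continuous w) (hwc : HasCompactSupport w) :
    pNorm p (moll k w) ≤ (∫ t, k t) * pNorm p w := by
  have hp := hpq.lt
  have hc := continuous_moll hk hkc hw
  have hcc := hasCompactSupport_moll hkc hwc
  refine le_of_rpow_le (p := p) (pNorm_nonneg _ _)
    (mul_nonneg (integral_nonneg hk0) (pNorm_nonneg _ _)) ?_
  rw [← integral_dualMap_mul_self hp]
  refine (integral_mul_moll_le hpq ((continuous_dualMap hp).comp hc)
    (hasCompactSupport_dualMap hp hcc) hk hkc hk0 hw hwc).trans_eq ?_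
  rw [show (dualMap p ∘ moll k w) = fun x => dualMap p (moll k w x) from rfl,
    pNorm_dualMap hpq]
  ring

theorem pNorm_add_le {p q : ℝ} (hpq : p.HolderConjugate q) {v w : Eu n → ℝ}
    (hv : Continuous v) (hvc : HasCompactSupport v)
    (hw : Continuous w) (hwc : HasCompactSupport w) :
    pNorm p (fun x => v x + w x) ≤ pNorm p v + pNorm p w := by
  have hp := hpq.lt
  have h1 : (1 : ℝ≥0∞) ≤ ENNReal.ofReal p := by
    rw [← ENNReal.ofReal_one]; exact ENNReal.ofReal_le_ofReal hp.le
  have := eLpNorm_add_le (μ := volume) (hv.aestronglyMeasurable) (hw.aestronglyMeasurable) h1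
  rw [eLpNorm_eq_pNorm (by linarith) hv hvc, eLpNorm_eq_pNorm (by linarith) hw hwc,
    eLpNorm_eq_pNorm (by linarith) (hv.add hw) (hvc.add hwc),
    ← ENNReal.ofReal_add (pNorm_nonneg _ _) (pNorm_nonneg _ _)] at this
  exact (ENNReal.ofReal_le_ofReal_iff (add_nonneg (pNorm_nonneg _ _) (pNorm_nonneg _ _))).1 this

end NonlocalPoincare

namespace NonlocalPoincare

open Filter Topology
open scoped Convolution

/-- The vector kernel `ρ(z) z / |z|²` of the nonlocal gradient. -/
def kerVec (ρ : Eu n → ℝ) (z : Eu n) : Eu n := (ρ z / ‖z‖ ^ 2) • z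

/-- Nonnegative integrable kernels supported in the closed ball of radius `R`. -/
structure IsCompactKernel (ρ : Eu n → ℝ) (R : ℝ) : Prop where
  pos : 0 < R
  nonneg : ∀ z, 0 ≤ ρ z
  integrable : Integrable ρ
  eq_zero : ∀ z, R < ‖z‖ → ρ z = 0

/-- Smooth compactly supported real functions on `ℝ^n`. -/
structure IsTest (w : Eu n → ℝ) : Prop where
  contDiff : ContDiff ℝ (⊤ : ℕ∞) w
  hasCompactSupport : HasCompactSupport w

theorem IsTest.continuous {w : Eu n → ℝ} (hw : IsTest w) : Continuous w := hw.contDiff.continuous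

theorem IsTest.exists_lipschitz {w : Eu n → ℝ} (hw : IsTest w) :
    ∃ L : ℝ, 0 ≤ L ∧ ∀ x y, |w x - w y| ≤ L * ‖x - y‖ := by
  obtain ⟨C, hC⟩ := hw.contDiff.lipschitzWith_of_hasCompactSupport hw.hasCompactSupport
    (by simp)
  refine ⟨C, C.2, fun x y => ?_⟩
  have := hC.dist_le_mul x y
  rwa [Real.dist_eq, dist_eq_norm] at this

theorem exists_radius {F : Type*} [Zero F] [TopologicalSpace F] {w : Eu n → F}
    (hw : HasCompactSupport w) : ∃ r : ℝ, 0 < r ∧ ∀ x, r < ‖x‖ → w x = 0 := by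
  obtain ⟨r, hr⟩ := hw.isCompact.isBounded.subset_closedBall 0
  refine ⟨max r 1, by positivity, fun x hx => ?_⟩
  refine image_eq_zero_of_notMem_tsupport fun h => ?_
  have := hr h
  rw [mem_closedBall_zero_iff] at this
  exact absurd (this.trans (le_max_left r 1)) hx.not_ge

theorem hasCompactSupport_of_radius {F : Type*} [Zero F] {w : Eu n → F} {r : ℝ}
    (h : ∀ x, r < ‖x‖ → w x = 0) : HasCompactSupport w := by
  refine HasCompactSupport.intro (isCompact_closedBall (0 : Eu n) r) fun x hx => h x ?_
  simpa using hx

section Kernel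

variable {ρ : Eu n → ℝ} {R : ℝ}

theorem nlGradS_eq (ρ : Eu n → ℝ) (w : Eu n → ℝ) (x : Eu n) :
    nlGradS ρ w x = ∫ z, (w x - w (x - z)) • kerVec ρ z := by
  rw [nlGradS, ← integral_sub_left_eq_self (fun z => (w x - w (x - z)) • kerVec ρ z) volume x]
  congr 1; ext1 y
  rw [kerVec, smul_smul, sub_sub_cancel, mul_div_assoc]

theorem IsCompactKernel.norm_mul_norm_kerVec_le (h : IsCompactKernel ρ R) (z : Eu n) :
    ‖z‖ * ‖kerVec ρ z‖ ≤ ρ z := by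
  rw [kerVec, norm_smul, Real.norm_of_nonneg (div_nonneg (h.nonneg z) (by positivity))]
  rcases eq_or_ne z 0 with rfl | hz
  · simpa using h.nonneg 0
  · have : ‖z‖ ≠ 0 := by simpa using hz
    apply le_of_eq
    field_simp

theorem kerVec_eq_zero {z : Eu n} (h : ρ z = 0) : kerVec ρ z = 0 := by
  simp [kerVec, h]

theorem IsCompactKernel.aestronglyMeasurable_kerVec (h : IsCompactKernel ρ R) :
    AEStronglyMeasurable (kerVec ρ) volume := by
  unfold kerVec
  have h1 : AEMeasurable (fun z => ρ z / ‖z‖ ^ 2) volume :=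
    h.integrable.aestronglyMeasurable.aemeasurable.div (by fun_prop)
  exact h1.aestronglyMeasurable.smul aestronglyMeasurable_id

theorem IsCompactKernel.norm_diff_smul_le (h : IsCompactKernel ρ R) {w : Eu n → ℝ} {L : ℝ}
    (hL : ∀ x y, |w x - w y| ≤ L * ‖x - y‖) (hL0 : 0 ≤ L) (x z : Eu n) :
    |w x - w (x - z)| * ‖kerVec ρ z‖ ≤ L * ρ z := by
  calc |w x - w (x - z)| * ‖kerVec ρ z‖ ≤ L * ‖z‖ * ‖kerVec ρ z‖ := by
        have := hL x (x - z)
        rw [sub_sub_cancel] at this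
        gcongr
    _ = L * (‖z‖ * ‖kerVec ρ z‖) := by ring
    _ ≤ L * ρ z := by
        gcongr
        exact h.norm_mul_norm_kerVec_le z

theorem IsCompactKernel.integrable_diff_smul (h : IsCompactKernel ρ R) {w : Eu n → ℝ}
    (hw : IsTest w) (x : Eu n) : Integrable fun z => (w x - w (x - z)) • kerVec ρ z := by
  obtain ⟨L, hL0, hL⟩ := hw.exists_lipschitz
  have := hw.continuous
  refine Integrable.mono' (h.integrable.const_mul L) ?_ (ae_of_all _ fun z => ?_)
  · have h1 : Continuous fun z => w x - w (x - z) := by fun_prop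
    exact h1.aestronglyMeasurable.smul h.aestronglyMeasurable_kerVec
  · rw [norm_smul]
    exact h.norm_diff_smul_le hL hL0 x z

theorem IsCompactKernel.continuous_nlGradS (h : IsCompactKernel ρ R) {w : Eu n → ℝ}
    (hw : IsTest w) : Continuous (nlGradS ρ w) := by
  obtain ⟨L, hL0, hL⟩ := hw.exists_lipschitz
  have hwc := hw.continuous
  rw [funext (nlGradS_eq ρ w)]
  refine continuous_of_dominated (bound := fun z => L * ρ z) (fun x => ?_)
    (fun x => ae_of_all _ fun z => ?_) (h.integrable.const_mul L) (ae_of_all _ fun z => ?_)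
  · exact (h.integrable_diff_smul hw x).aestronglyMeasurable
  · rw [norm_smul]
    exact h.norm_diff_smul_le hL hL0 x z
  · fun_prop

theorem IsCompactKernel.diff_smul_eq_zero (h : IsCompactKernel ρ R) {w : Eu n → ℝ} {r : ℝ}
    (hw : ∀ x, r < ‖x‖ → w x = 0) {x : Eu n} (hx : r + R < ‖x‖) (z : Eu n) :
    (w x - w (x - z)) • kerVec ρ z = 0 := by
  by_cases hz : R < ‖z‖
  · rw [kerVec_eq_zero (h.eq_zero z hz), smul_zero]
  · have h1 : ‖x‖ ≤ ‖x - z‖ + ‖z‖ := by simpa using norm_add_le (x - z) z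
    have := h.pos
    rw [hw x (by linarith), hw (x - z) (by linarith), sub_zero, zero_smul]

theorem IsCompactKernel.nlGradS_eq_zero (h : IsCompactKernel ρ R) {w : Eu n → ℝ} {r : ℝ}
    (hw : ∀ x, r < ‖x‖ → w x = 0) {x : Eu n} (hx : r + R < ‖x‖) : nlGradS ρ w x = 0 := by
  rw [nlGradS_eq]
  simp only [h.diff_smul_eq_zero hw hx, integral_zero]

theorem IsCompactKernel.hasCompactSupport_nlGradS (h : IsCompactKernel ρ R) {w : Eu n → ℝ}
    (hw : IsTest w) : HasCompactSupport (nlGradS ρ w) := by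
  obtain ⟨r, -, hr⟩ := exists_radius hw.hasCompactSupport
  exact hasCompactSupport_of_radius (r := r + R) fun x hx => h.nlGradS_eq_zero hr hx

/-- Fubini for the pairing of the nonlocal gradient with a continuous field of operators. -/
theorem IsCompactKernel.integral_apply_nlGradS (h : IsCompactKernel ρ R) {w : Eu n → ℝ}
    (hw : IsTest w) {G : Type*} [NormedAddCommGroup G] [NormedSpace ℝ G] [CompleteSpace G]
    {ψ : Eu n → Eu n →L[ℝ] G} (hψ : Continuous ψ) :
    ∫ x, ψ x (nlGradS ρ w x) = ∫ z, ∫ x, (w x - w (x - z)) • ψ x (kerVec ρ z) := by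
  obtain ⟨r, -, hr⟩ := exists_radius hw.hasCompactSupport
  obtain ⟨L, hL0, hL⟩ := hw.exists_lipschitz
  have hwc := hw.continuous
  have hint : Integrable (Function.uncurry fun x z => (w x - w (x - z)) • ψ x (kerVec ρ z))
      (volume.prod volume) := by
    have hG : Integrable ((closedBall (0 : Eu n) (r + R)).indicator fun x => ‖ψ x‖) :=
      (hψ.norm.continuousOn.integrableOn_compact
        (isCompact_closedBall _ _)).integrable_indicator measurableSet_closedBall
    refine Integrable.mono' (hG.mul_prod (h.integrable.const_mul L)) ?_
      (ae_of_all _ ?_)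
    · refine AEStronglyMeasurable.smul
        (f := fun q : Eu n × Eu n => w q.1 - w (q.1 - q.2))
        (g := fun q : Eu n × Eu n => ψ q.1 (kerVec ρ q.2)) ?_ ?_
      · exact Continuous.aestronglyMeasurable (by fun_prop)
      · have h1 : AEStronglyMeasurable (fun q : Eu n × Eu n => ψ q.1) (volume.prod volume) :=
          Continuous.aestronglyMeasurable (by fun_prop)
        have h2 : AEStronglyMeasurable (fun q : Eu n × Eu n => kerVec ρ q.2)
            (volume.prod volume) := h.aestronglyMeasurable_kerVec.comp_snd
        exact (ContinuousLinearMap.id ℝ (Eu n →L[ℝ] G)).aestronglyMeasurable_comp₂ h1 h2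
    · rintro ⟨x, z⟩
      simp only [Function.uncurry]
      by_cases hx : r + R < ‖x‖
      · have : (w x - w (x - z)) • ψ x (kerVec ρ z) = 0 := by
          rw [← map_smul, h.diff_smul_eq_zero hr hx, map_zero]
        rw [this, norm_zero]
        exact mul_nonneg (indicator_nonneg (fun _ _ => norm_nonneg _) _)
          (mul_nonneg hL0 (h.nonneg z))
      · rw [indicator_of_mem (by simpa using hx), norm_smul]
        calc ‖w x - w (x - z)‖ * ‖ψ x (kerVec ρ z)‖
            ≤ ‖w x - w (x - z)‖ * (‖ψ x‖ * ‖kerVec ρ z‖) := by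
              gcongr
              exact (ψ x).le_opNorm _
          _ = ‖ψ x‖ * (|w x - w (x - z)| * ‖kerVec ρ z‖) := by rw [Real.norm_eq_abs]; ring
          _ ≤ _ := mul_le_mul_of_nonneg_left (h.norm_diff_smul_le hL hL0 x z) (norm_nonneg _)
  rw [← integral_integral_swap hint]
  congr 1; ext1 x
  rw [nlGradS_eq, ← ContinuousLinearMap.integral_comp_comm _ (h.integrable_diff_smul hw x)]
  simp only [map_smul]

theorem IsTest.moll {k w : Eu n → ℝ} (hk : IsTest k) (hw : IsTest w) : IsTest (moll k w) :=
  ⟨contDiff_moll hk.contDiff hk.hasCompactSupport hw.continuous,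
    hasCompactSupport_moll hk.hasCompactSupport hw.hasCompactSupport⟩

theorem IsCompactKernel.nlGradS_moll (h : IsCompactKernel ρ R) {k w : Eu n → ℝ}
    (hk : IsTest k) (hw : IsTest w) (x : Eu n) :
    nlGradS ρ (moll k w) x = ∫ t, k t • nlGradS ρ w (x - t) := by
  have hkc := hk.continuous
  have hwc := hw.continuous
  rw [← integral_sub_left_eq_self (fun t => k t • nlGradS ρ w (x - t)) volume x]
  have hψ : Continuous fun y => k (x - y) • ContinuousLinearMap.id ℝ (Eu n) := by fun_prop
  have := h.integral_apply_nlGradS hw hψ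
  simp only [_root_.smul_apply, ContinuousLinearMap.id_apply] at this
  simp only [sub_sub_cancel]
  rw [this, nlGradS_eq]
  congr 1; ext1 z
  have e : moll k w (x - z) = ∫ y, k (x - y) * w (y - z) := by
    rw [moll_swap, ← integral_sub_right_eq_self _ z]
    congr 1; ext1 y; congr 2; abel
  have hks : HasCompactSupport fun y => k (x - y) :=
    hk.hasCompactSupport.comp_homeomorph (Homeomorph.subLeft x)
  rw [moll_swap, e, ← integral_sub]
  · rw [← integral_smul_const]
    congr 1; ext1 y
    rw [smul_smul]; congr 1; ring
  · exact Continuous.integrable_of_hasCompactSupport (by fun_prop) hks.mul_right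
  · exact Continuous.integrable_of_hasCompactSupport (by fun_prop) hks.mul_right

theorem IsCompactKernel.pNorm_nlGradS_moll_le (h : IsCompactKernel ρ R) {p q : ℝ}
    (hpq : p.HolderConjugate q) {k w : Eu n → ℝ} (hk : IsTest k) (hk0 : ∀ x, 0 ≤ k x)
    (hk1 : ∫ x, k x = 1) (hw : IsTest w) :
    pNorm p (nlGradS ρ (moll k w)) ≤ pNorm p (nlGradS ρ w) := by
  have hc := (h.continuous_nlGradS hw).norm
  have hcc := (h.hasCompactSupport_nlGradS hw).norm
  refine (pNorm_mono hpq.pos (continuous_moll hk.continuous hk.hasCompactSupport hc)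
    (hasCompactSupport_moll hk.hasCompactSupport hcc) fun x => ?_).trans
    ((pNorm_moll_le hpq hk.continuous hk.hasCompactSupport hk0 hc hcc).trans_eq ?_)
  · rw [h.nlGradS_moll hk hw, Real.norm_of_nonneg (moll_nonneg hk0 (fun _ => norm_nonneg _) x)]
    refine (norm_integral_le_integral_norm _).trans_eq ?_
    simp only [norm_smul, moll, Real.norm_of_nonneg (hk0 _)]
  · rw [hk1, one_mul, pNorm_norm]

end Kernel
end NonlocalPoincare

namespace NonlocalPoincare

open Filter Topology
open scoped Convolution

/-- A fixed smooth bump function at the origin, supported in the unit ball. -/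
def baseBump (n : ℕ) : ContDiffBump (0 : Eu n) := ⟨1 / 2, 1, by norm_num, by norm_num⟩

/-- The standard even mollifier at unit scale. -/
def eta1 (x : Eu n) : ℝ := (baseBump n).normed volume x

/-- The standard even mollifier at scale `r`. -/
def eta (r : ℝ) (x : Eu n) : ℝ := (r ^ n)⁻¹ * eta1 (r⁻¹ • x)

theorem isTest_eta1 : IsTest (eta1 : Eu n → ℝ) :=
  ⟨(baseBump n).contDiff_normed, (baseBump n).hasCompactSupport_normed⟩

theorem eta1_nonneg (x : Eu n) : 0 ≤ eta1 x := (baseBump n).nonneg_normed x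

theorem eta1_neg (x : Eu n) : eta1 (-x) = eta1 x := (baseBump n).normed_neg x

theorem eta1_eq_zero {x : Eu n} (hx : 1 ≤ ‖x‖) : eta1 x = 0 := by
  have : x ∉ Function.support ((baseBump n).normed volume) := by
    rw [ContDiffBump.support_normed_eq]
    simpa [baseBump] using hx
  exact Function.notMem_support.1 this

theorem exists_eta1_le : ∃ M : ℝ, 0 < M ∧ ∀ x : Eu n, eta1 x ≤ M := by
  obtain ⟨M, hM⟩ := isTest_eta1.continuous.bounded_above_of_compact_support
    (isTest_eta1 (n := n)).hasCompactSupport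
  exact ⟨max M 1, by positivity, fun x =>
    (Real.le_norm_self _).trans ((hM x).trans (le_max_left _ _))⟩

section Eta

variable {r : ℝ}

theorem isTest_eta (hr : 0 < r) : IsTest (eta r : Eu n → ℝ) := by
  refine ⟨contDiff_const.mul (isTest_eta1.contDiff.comp (contDiff_const_smul _)), ?_⟩
  refine HasCompactSupport.mul_left ?_
  exact isTest_eta1.hasCompactSupport.comp_homeomorph
    (Homeomorph.smulOfNeZero r⁻¹ (inv_ne_zero hr.ne'))

theorem eta_nonneg (hr : 0 < r) (x : Eu n) : 0 ≤ eta r x :=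
  mul_nonneg (by positivity) (eta1_nonneg _)

theorem eta_neg (x : Eu n) : eta r (-x) = eta r x := by
  simp [eta, smul_neg, eta1_neg]

theorem eta_eq_zero (hr : 0 < r) {x : Eu n} (hx : r ≤ ‖x‖) : eta r x = 0 := by
  rw [eta, eta1_eq_zero, mul_zero]
  rw [norm_smul, norm_inv, Real.norm_of_nonneg hr.le]
  rwa [le_inv_mul_iff₀ hr, mul_one]

theorem integral_eta (hr : 0 < r) : ∫ x : Eu n, eta r x = 1 := by
  simp only [eta]
  rw [integral_const_mul, Measure.integral_comp_inv_smul_of_nonneg _ _ hr.le]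
  have : ∫ x : Eu n, eta1 x = 1 := (baseBump n).integral_normed
  rw [this]
  have : r ^ n ≠ 0 := by positivity
  simp [this]

theorem fderiv_eta (x : Eu n) :
    fderiv ℝ (eta r) x = (r ^ n)⁻¹ • r⁻¹ • fderiv ℝ eta1 (r⁻¹ • x) := by
  have h : Differentiable ℝ (eta1 : Eu n → ℝ) := isTest_eta1.contDiff.differentiable (by simp)
  have h2 : HasFDerivAt (fun x : Eu n => eta1 (r⁻¹ • x))
      ((fderiv ℝ eta1 (r⁻¹ • x)).comp (r⁻¹ • ContinuousLinearMap.id ℝ (Eu n))) x :=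
    (h _).hasFDerivAt.comp x ((hasFDerivAt_id x).const_smul r⁻¹)
  have h3 := (h2.const_mul ((r ^ n)⁻¹)).fderiv
  rw [show eta r = fun x : Eu n => (r ^ n)⁻¹ * eta1 (r⁻¹ • x) from rfl, h3]
  ext y
  simp

theorem integral_norm_fderiv_eta (hr : 0 < r) :
    ∫ x : Eu n, ‖fderiv ℝ (eta r) x‖ = (∫ x : Eu n, ‖fderiv ℝ eta1 x‖) / r := by
  simp only [fderiv_eta, norm_smul]
  rw [integral_const_mul, integral_const_mul,
    Measure.integral_comp_inv_smul_of_nonneg volume (fun x : Eu n => ‖fderiv ℝ eta1 x‖) hr.le]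
  have : r ^ n ≠ 0 := by positivity
  rw [norm_inv, norm_inv, Real.norm_of_nonneg hr.le, Real.norm_of_nonneg (by positivity)]
  simp only [finrank_euclideanSpace, Fintype.card_fin, smul_eq_mul]
  field_simp

end Eta

theorem IsTest.continuous_fderiv {w : Eu n → ℝ} (hw : IsTest w) : Continuous (fderiv ℝ w) :=
  hw.contDiff.continuous_fderiv (by simp)

theorem norm_fderiv_moll_le {k w : Eu n → ℝ} (hk : IsTest k) (hw : Continuous w) (y : Eu n) :
    ‖fderiv ℝ (moll k w) y‖ ≤ moll (fun t => ‖fderiv ℝ k t‖) (fun x => ‖w x‖) y := by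
  have h := (hk.hasCompactSupport.hasFDerivAt_convolution_left
    (ContinuousLinearMap.mul ℝ ℝ) (μ := volume) (hk.contDiff.of_le (by simp))
    hw.locallyIntegrable y).fderiv
  rw [moll_eq_convolution, h]
  refine (norm_integral_le_integral_norm _).trans (integral_mono_of_nonneg
    (ae_of_all _ fun _ => norm_nonneg _) ?_ (ae_of_all _ fun t => ?_))
  · exact integrable_conv hk.continuous_fderiv.norm
      (hk.hasCompactSupport.fderiv (𝕜 := ℝ)).norm hw.norm y
  · refine ContinuousLinearMap.opNorm_le_bound _ (by positivity) fun h => ?_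
    simp only [ContinuousLinearMap.precompL_apply, ContinuousLinearMap.mul_apply', norm_mul]
    calc ‖fderiv ℝ k t h‖ * ‖w (y - t)‖ ≤ ‖fderiv ℝ k t‖ * ‖h‖ * ‖w (y - t)‖ := by
          gcongr
          exact ContinuousLinearMap.le_opNorm _ _
      _ = _ := by ring

/-- Mollification with an even kernel is self-adjoint. -/
theorem integral_mul_moll_comm {k F w : Eu n → ℝ} (hk : Continuous k)
    (hkc : HasCompactSupport k) (hke : ∀ x, k (-x) = k x) (hF : Continuous F)
    (hFc : HasCompactSupport F) (hw : Continuous w) (hwc : HasCompactSupport w) :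
    ∫ x, F x * moll k w x = ∫ x, moll k F x * w x := by
  have h1 : ∫ x, moll k F x * w x = ∫ x, w x * moll k F x := by simp only [mul_comm]
  rw [h1, integral_mul_moll hF hFc hk hkc hw, integral_mul_moll hw hwc hk hkc hF,
    ← integral_neg_eq_self]
  congr 1; ext1 t
  rw [hke, ← integral_sub_right_eq_self _ t]
  congr 2; ext1 x
  rw [sub_sub, add_neg_cancel, sub_zero, mul_comm]

/-- The correlation `z ↦ ∫ F(y) w(y - z) dy`. -/
def corr (F w : Eu n → ℝ) (z : Eu n) : ℝ := ∫ y, F y * w (y - z)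

theorem moll_translate (k w : Eu n → ℝ) (z x : Eu n) :
    moll k w (x - z) = moll k (fun y => w (y - z)) x := by
  simp only [moll]
  congr 1; ext1 t; rw [sub_right_comm]

theorem corr_moll {k F w : Eu n → ℝ} (hk : Continuous k)
    (hkc : HasCompactSupport k) (hke : ∀ x, k (-x) = k x) (hF : Continuous F)
    (hFc : HasCompactSupport F) (hw : Continuous w) (hwc : HasCompactSupport w) :
    corr F (moll k w) = corr (moll k F) w := by
  ext1 z
  simp only [corr, moll_translate]
  exact integral_mul_moll_comm hk hkc hke hF hFc (w := fun y => w (y - z)) (by fun_prop)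
    (hwc.comp_homeomorph (Homeomorph.subRight z))

theorem corr_eq_moll (F w : Eu n → ℝ) : corr F w = moll (fun y => w (-y)) F := by
  ext1 z
  rw [corr, moll, ← integral_sub_left_eq_self _ volume z]
  congr 1; ext1 t
  rw [sub_sub_cancel_left, mul_comm]

theorem contDiff_corr {F w : Eu n → ℝ} (hF : IsTest F) (hw : IsTest w) :
    ContDiff ℝ (⊤ : ℕ∞) (corr F w) := by
  rw [corr_eq_moll]
  exact contDiff_moll (hw.contDiff.comp contDiff_neg)
    (hw.hasCompactSupport.comp_homeomorph (Homeomorph.neg _)) hF.continuous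

theorem fderiv_corr {F w : Eu n → ℝ} (hF : IsTest F) (hw : IsTest w) (z h : Eu n) :
    fderiv ℝ (corr F w) z h = ∫ y, w (y - z) * fderiv ℝ F y h := by
  have hwc : HasCompactSupport fun y => w (-y) :=
    hw.hasCompactSupport.comp_homeomorph (Homeomorph.neg _)
  have hwcont := hw.continuous
  have hw' : Continuous fun y => w (-y) := by fun_prop
  have := (hF.hasCompactSupport.hasFDerivAt_convolution_right
    (ContinuousLinearMap.mul ℝ ℝ) (μ := volume) hw'.locallyIntegrable
    (hF.contDiff.of_le (by simp)) z).fderiv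
  rw [corr_eq_moll, moll_eq_convolution, this, convolution_precompR_apply _
    hw'.locallyIntegrable (hF.hasCompactSupport.fderiv (𝕜 := ℝ)) hF.continuous_fderiv,
    convolution, ← integral_sub_left_eq_self _ volume z]
  simp

end NonlocalPoincare

namespace NonlocalPoincare

open Filter Topology

/-- The scalar weight `ρ(z)/|z|²`. -/
def weight (ρ : Eu n → ℝ) (z : Eu n) : ℝ := ρ z / ‖z‖ ^ 2

theorem one_add_le_rpow {ν h : ℝ} (hν : 0 < ν) (h0 : 0 < h) (h1 : h ≤ 1) :
    1 + ν / 2 * h ≤ (1 + h) ^ ν := by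
  have hpos : 0 < 1 + h := by linarith
  have hlog : h / 2 ≤ Real.log (1 + h) := by
    have := Real.one_sub_inv_le_log_of_pos hpos
    refine le_trans ?_ this
    rw [← sub_nonneg]
    have : 1 - (1 + h)⁻¹ - h / 2 = h * (1 - h) / (2 * (1 + h)) := by
      field_simp; ring
    rw [this]
    have : 0 ≤ 1 - h := by linarith
    positivity
  rw [Real.rpow_def_of_pos hpos]
  have := Real.add_one_le_exp (Real.log (1 + h) * ν)
  nlinarith

section Radial

variable {ρ : Eu n → ℝ} {ρb : ℝ → ℝ} {ε R : ℝ}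

theorem exists_norm_eq (hn : 0 < n) {r : ℝ} (hr : 0 < r) : ∃ x : Eu n, x ≠ 0 ∧ ‖x‖ = r := by
  have h : ‖EuclideanSpace.single (⟨0, hn⟩ : Fin n) r‖ = r := by
    rw [EuclideanSpace.single, PiLp.norm_single, Real.norm_of_nonneg hr.le]
  exact ⟨_, fun h0 => by rw [h0, norm_zero] at h; exact hr.ne h, h⟩

theorem fRho_nonneg (hn : 0 < n) (h0 : IsKernelH0 n ρ ρb ε) {r : ℝ} (hr : 0 < r) :
    0 ≤ fRho n ρb r := by
  obtain ⟨x, hx, rfl⟩ := exists_norm_eq hn hr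
  rw [fRho, ← h0.2.1 x hx]
  exact mul_nonneg (Real.rpow_nonneg (norm_nonneg _) _) (h0.1 x)

theorem fRho_eq_zero (hn : 0 < n) (h0 : IsKernelH0 n ρ ρb ε) (hK : IsCompactKernel ρ R) {r : ℝ}
    (hr : R < r) : fRho n ρb r = 0 := by
  obtain ⟨x, hx, rfl⟩ := exists_norm_eq hn (hK.pos.trans hr)
  rw [fRho, ← h0.2.1 x hx, hK.eq_zero x hr, mul_zero]

theorem weight_eq (h0 : IsKernelH0 n ρ ρb ε) {z : Eu n} (hz : z ≠ 0) :
    weight ρ z = (‖z‖ ^ n)⁻¹ * fRho n ρb ‖z‖ := by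
  have hpos : 0 < ‖z‖ := norm_pos_iff.2 hz
  rw [weight, fRho, h0.2.1 z hz, Real.rpow_sub hpos, Real.rpow_natCast, Real.rpow_two]
  field_simp

theorem weight_dilate (h0 : IsKernelH0 n ρ ρb ε) {z : Eu n} (hz : z ≠ 0) {l : ℝ} (hl : 0 < l) :
    (l ^ n)⁻¹ * weight ρ (l⁻¹ • z) = (‖z‖ ^ n)⁻¹ * fRho n ρb (‖z‖ / l) := by
  have h : ‖l⁻¹ • z‖ = ‖z‖ / l := by
    rw [norm_smul, norm_inv, Real.norm_of_nonneg hl.le, inv_mul_eq_div]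
  have hpos : 0 < ‖z‖ := norm_pos_iff.2 hz
  rw [weight_eq h0 (smul_ne_zero (inv_ne_zero hl.ne') hz), h]
  rw [div_pow]
  field_simp

theorem exists_fRho_lower (hn : 0 < n) (h0 : IsKernelH0 n ρ ρb ε) (h3 : IsKernelH3 n ρb ε) :
    ∃ s ∈ Ioo (0 : ℝ) 1, ∃ c > 0, ∀ r ∈ Ioo 0 (ε / 2), c * r ^ (-(1 + s)) ≤ fRho n ρb r := by
  obtain ⟨s, hs, C, hC, h⟩ := h3
  obtain ⟨-, hrad, -, -, hε, c, hc, hlow⟩ := h0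
  have hε2 : 0 < ε / 2 := by linarith
  obtain ⟨x, hx, hxn⟩ := exists_norm_eq hn hε2
  have hρb : 0 < ρb (ε / 2) := by
    rw [← hxn, ← hrad x hx]
    exact hc.trans_le (hlow x (by rw [mem_closedBall_zero_iff, hxn]; linarith) hx)
  refine ⟨s, hs, C * ((ε / 2) ^ ((n : ℝ) + s - 1) * ρb (ε / 2)), by positivity, fun r hr => ?_⟩
  have := h r ⟨hr.1, by linarith [hr.2]⟩ (ε / 2) ⟨hε2, by linarith⟩ hr.2.le
  have hr0 := hr.1
  rw [Real.rpow_neg hr0.le, ← div_eq_mul_inv, div_le_iff₀ (by positivity)]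
  refine this.trans_eq ?_
  rw [fRho, mul_right_comm, ← Real.rpow_add hr0]
  congr 2; ring

theorem fRho_dilate_lower (hn : 0 < n) (h0 : IsKernelH0 n ρ ρb ε) {ν : ℝ} (hν : 0 < ν)
    (h1 : AntitoneOn (fun r => r ^ ν * fRho n ρb r) (Ioo 0 ε)) {r h : ℝ} (hr : r ∈ Ioo 0 ε)
    (hh0 : 0 < h) (hh1 : h ≤ 1) :
    h * (ν / 2 * fRho n ρb r) ≤ fRho n ρb (r / (1 + h)) - fRho n ρb r := by
  have hl : 0 < 1 + h := by linarith
  have hr0 := hr.1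
  have hle : r / (1 + h) ≤ r := div_le_self hr0.le (by linarith)
  have hd : 0 < r / (1 + h) := by positivity
  have h2 := h1 ⟨hd, hle.trans_lt hr.2⟩ hr hle
  simp only [Real.div_rpow hr0.le hl.le] at h2
  have h3 : (1 + h) ^ ν * fRho n ρb r ≤ fRho n ρb (r / (1 + h)) := by
    have hp1 : 0 < (1 + h) ^ ν := Real.rpow_pos_of_pos hl _
    have hp2 : 0 < r ^ ν := Real.rpow_pos_of_pos hr0 _
    rw [div_mul_eq_mul_div, le_div_iff₀ hp1] at h2
    refine le_of_mul_le_mul_left ?_ hp2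
    linarith
  have h4 := mul_le_mul_of_nonneg_right (one_add_le_rpow hν hh0 hh1)
    (fRho_nonneg hn h0 hr0)
  linarith

theorem exists_fRho_dilate_far (hn : 0 < n) (h0 : IsKernelH0 n ρ ρb ε) (hK : IsCompactKernel ρ R)
    (h2 : IsKernelH2 n ρb ε) {δ : ℝ} (hδ : 0 < δ) :
    ∃ C : ℝ, 0 ≤ C ∧ ∀ r h, δ ≤ r → 0 < h → h ≤ 1 →
      |fRho n ρb (r / (1 + h)) - fRho n ρb r| ≤ h * C * (if r ≤ 2 * R then 1 else 0) := by
  have hR := hK.pos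
  obtain ⟨L, hL⟩ := (h2.1.mono (fun x (hx : x ∈ Icc (δ / 2) (2 * R)) =>
    (by have := hx.1; simp; linarith : x ∈ Ioi (0 : ℝ)))).exists_lipschitzOnWith
    (by simp) (convex_Icc _ _) isCompact_Icc
  refine ⟨L * (2 * R), by positivity, fun r h hr hh0 hh1 => ?_⟩
  have hl : 0 < 1 + h := by linarith
  have hr0 : 0 < r := hδ.trans_le hr
  have hhalf : r / 2 ≤ r / (1 + h) := by gcongr; linarith
  have hle : r / (1 + h) ≤ r := div_le_self hr0.le (by linarith)
  split_ifs with hrR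
  · have h3 := hL.dist_le_mul (r / (1 + h)) ⟨by linarith, by linarith⟩ r ⟨by linarith, hrR⟩
    rw [Real.dist_eq, Real.dist_eq] at h3
    have h4 : |r / (1 + h) - r| ≤ h * (2 * R) := by
      rw [abs_sub_comm, abs_of_nonneg (by linarith)]
      have : r - r / (1 + h) = h * (r / (1 + h)) := by field_simp; ring
      rw [this]
      gcongr
      linarith
    calc _ ≤ L * |r / (1 + h) - r| := h3
      _ ≤ L * (h * (2 * R)) := by gcongr
      _ = _ := by ring
  · push Not at hrR
    rw [fRho_eq_zero hn h0 hK (by linarith), fRho_eq_zero hn h0 hK (by linarith)]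
    simp

/-- Pointwise lower bound for the increment of the weight under dilations. -/
theorem exists_weight_dilate_lower (hn : 0 < n) (h0 : IsKernelH0 n ρ ρb ε)
    (hK : IsCompactKernel ρ R) (h1 : IsKernelH1 n ρb ε) (h2 : IsKernelH2 n ρb ε)
    (h3 : IsKernelH3 n ρb ε) :
    ∃ s ∈ Ioo (0 : ℝ) 1, ∃ c > 0, ∃ C ≥ 0, ∀ h r' : ℝ, 0 < h → h ≤ 1 → 0 < r' → r' ≤ ε / 2 →
      ∀ z : Eu n, z ≠ 0 →
        h * (c * r' ^ (-(1 + s)) * eta r' z - C * (closedBall (0 : Eu n) (2 * R)).indicator 1 z) ≤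
          ((1 + h) ^ n)⁻¹ * weight ρ ((1 + h)⁻¹ • z) - weight ρ z := by
  obtain ⟨ν, hν, -, hanti⟩ := h1
  obtain ⟨s, hs, c, hc, hlow⟩ := exists_fRho_lower hn h0 h3
  have hε : 0 < ε := h0.2.2.2.2.1
  have hδ : 0 < ε / 2 := by linarith
  obtain ⟨C, hC, hfar⟩ := exists_fRho_dilate_far hn h0 hK h2 hδ
  obtain ⟨M, hM, hη⟩ := exists_eta1_le (n := n)
  refine ⟨s, hs, ν / 2 * c / M, by positivity, ((ε / 2) ^ n)⁻¹ * C, by positivity, ?_⟩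
  intro h r' hh0 hh1 hr0 hr' z hz
  have hz0 : 0 < ‖z‖ := norm_pos_iff.2 hz
  have hs0 := hs.1
  rw [weight_dilate h0 hz (by linarith), weight_eq h0 hz, ← mul_sub]
  have hind : 0 ≤ (closedBall (0 : Eu n) (2 * R)).indicator (1 : Eu n → ℝ) z :=
    indicator_nonneg (fun _ _ => zero_le_one) z
  rcases lt_or_ge ‖z‖ (ε / 2) with hzε | hzε
  · have e1 := fRho_dilate_lower hn h0 hν hanti ⟨hz0, by linarith⟩ hh0 hh1
    have e2 := hlow ‖z‖ ⟨hz0, hzε⟩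
    have e3 : r' ^ (-(1 + s)) * eta r' z ≤ M * ((‖z‖ ^ n)⁻¹ * ‖z‖ ^ (-(1 + s))) := by
      rcases lt_or_ge ‖z‖ r' with hlt | hge
      · have k1 : r' ^ (-(1 + s)) ≤ ‖z‖ ^ (-(1 + s)) :=
          Real.rpow_le_rpow_of_nonpos hz0 hlt.le (by linarith)
        have k2 : eta r' z ≤ (‖z‖ ^ n)⁻¹ * M := by
          rw [eta]
          have := eta1_nonneg (r'⁻¹ • z)
          gcongr
          exact hη _
        calc _ ≤ ‖z‖ ^ (-(1 + s)) * ((‖z‖ ^ n)⁻¹ * M) :=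
              mul_le_mul k1 k2 (eta_nonneg hr0 z) (by positivity)
          _ = _ := by ring
      · rw [eta_eq_zero hr0 hge, mul_zero]
        positivity
    calc _ ≤ h * (ν / 2 * c / M * r' ^ (-(1 + s)) * eta r' z) := by
          gcongr
          have : 0 ≤ ((ε / 2) ^ n)⁻¹ * C * (closedBall (0 : Eu n) (2 * R)).indicator 1 z := by
            positivity
          linarith
      _ = h * (ν / 2 * c / M) * (r' ^ (-(1 + s)) * eta r' z) := by ring
      _ ≤ h * (ν / 2 * c / M) * (M * ((‖z‖ ^ n)⁻¹ * ‖z‖ ^ (-(1 + s)))) := by gcongr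
      _ = (‖z‖ ^ n)⁻¹ * (h * (ν / 2 * (c * ‖z‖ ^ (-(1 + s))))) := by field_simp
      _ ≤ (‖z‖ ^ n)⁻¹ * (h * (ν / 2 * fRho n ρb ‖z‖)) := by gcongr
      _ ≤ _ := by gcongr
  · rw [eta_eq_zero hr0 (hr'.trans hzε), mul_zero, zero_sub]
    have e1 := (abs_le.1 (hfar ‖z‖ h hzε hh0 hh1)).1
    have e2 : (closedBall (0 : Eu n) (2 * R)).indicator (1 : Eu n → ℝ) z =
        if ‖z‖ ≤ 2 * R then 1 else 0 := by
      split_ifs with hz2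
      · rw [indicator_of_mem (mem_closedBall_zero_iff.2 hz2), Pi.one_apply]
      · rw [indicator_of_notMem fun hm => hz2 (mem_closedBall_zero_iff.1 hm)]
    rw [← e2] at e1
    have e3 : (‖z‖ ^ n)⁻¹ ≤ ((ε / 2) ^ n)⁻¹ := by gcongr
    calc _ = -(((ε / 2) ^ n)⁻¹ * (h * C * (closedBall (0 : Eu n) (2 * R)).indicator 1 z)) := by
          ring
      _ ≤ -((‖z‖ ^ n)⁻¹ * (h * C * (closedBall (0 : Eu n) (2 * R)).indicator 1 z)) := by
          apply neg_le_neg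
          gcongr
      _ ≤ _ := by
          rw [← mul_neg]
          gcongr

end Radial
end NonlocalPoincare

namespace NonlocalPoincare

open Filter Topology

section Quadratic

variable {B : Eu n → ℝ}

theorem exists_norm_fderiv_le (hB : ContDiff ℝ (⊤ : ℕ∞) B) (hB0 : fderiv ℝ B 0 = 0) (R : ℝ) :
    ∃ L : ℝ, 0 ≤ L ∧ ∀ y : Eu n, ‖y‖ ≤ R → ‖fderiv ℝ B y‖ ≤ L * ‖y‖ := by
  have h1 : ContDiff ℝ 1 (fderiv ℝ B) := hB.fderiv_right (by norm_cast)
  obtain ⟨L, hL⟩ := h1.contDiffOn.exists_lipschitzOnWith (s := closedBall (0 : Eu n) R)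
    (by simp) (convex_closedBall _ _) (isCompact_closedBall _ _)
  refine ⟨L, L.2, fun y hy => ?_⟩
  have := hL.dist_le_mul y (by simpa using hy) 0
    (by simpa using (norm_nonneg y).trans hy)
  simpa [hB0, dist_eq_norm] using this

theorem abs_sub_le_of_norm_fderiv_le (hB : ContDiff ℝ (⊤ : ℕ∞) B) {L r : ℝ} (hL : 0 ≤ L)
    (h : ∀ y : Eu n, ‖y‖ ≤ r → ‖fderiv ℝ B y‖ ≤ L * ‖y‖) {x y : Eu n} {t : ℝ} (ht : t ≤ r)
    (hx : ‖x‖ ≤ t) (hy : ‖y‖ ≤ t) : |B x - B y| ≤ L * t * ‖x - y‖ := by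
  have hd : Differentiable ℝ B := hB.differentiable (by simp)
  refine Convex.norm_image_sub_le_of_norm_fderiv_le (𝕜 := ℝ) (s := closedBall (0 : Eu n) t)
    (fun z _ => hd z) (fun z hz => ?_) (convex_closedBall _ _) (by simpa using hy)
    (by simpa using hx)
  rw [mem_closedBall_zero_iff] at hz
  exact (h z (hz.trans ht)).trans (by gcongr)

end Quadratic

section Limit

variable {ρ : Eu n → ℝ} {R : ℝ} {B : Eu n → ℝ}

theorem IsCompactKernel.weight_nonneg (hK : IsCompactKernel ρ R) (z : Eu n) : 0 ≤ weight ρ z :=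
  div_nonneg (hK.nonneg z) (by positivity)

theorem IsCompactKernel.weight_mul_le (hK : IsCompactKernel ρ R) {a C : ℝ} {z : Eu n}
    (hC : 0 ≤ C) (h : ‖z‖ ≤ R → |a| ≤ C * ‖z‖ ^ 2) : |weight ρ z * a| ≤ C * ρ z := by
  rw [abs_mul, abs_of_nonneg (hK.weight_nonneg z), weight]
  rcases le_or_gt ‖z‖ R with hz | hz
  · rcases eq_or_ne z 0 with rfl | hz0
    · have := hK.nonneg 0
      simp; positivity
    · have hz0 : 0 < ‖z‖ := norm_pos_iff.2 hz0
      have := hK.nonneg z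
      calc ρ z / ‖z‖ ^ 2 * |a| ≤ ρ z / ‖z‖ ^ 2 * (C * ‖z‖ ^ 2) := by gcongr; exact h hz
        _ = _ := by field_simp
  · simp [hK.eq_zero z hz]

theorem IsCompactKernel.aestronglyMeasurable_weight (hK : IsCompactKernel ρ R) :
    AEStronglyMeasurable (weight ρ) volume :=
  (hK.integrable.aestronglyMeasurable.aemeasurable.div
    (by fun_prop : AEMeasurable (fun z : Eu n => ‖z‖ ^ 2) volume)).aestronglyMeasurable

theorem IsCompactKernel.tendsto_quotient (hK : IsCompactKernel ρ R)
    (hB : ContDiff ℝ (⊤ : ℕ∞) B) (hB' : fderiv ℝ B 0 = 0) :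
    Tendsto (fun h : ℝ => ∫ z, weight ρ z * (h⁻¹ * (B ((1 + h) • z) - B z))) (𝓝[>] 0)
      (𝓝 (∫ z, fderiv ℝ B z (kerVec ρ z))) := by
  obtain ⟨L, hL, hLB⟩ := exists_norm_fderiv_le hB hB' (2 * R)
  have hBc := hB.continuous
  have hd : Differentiable ℝ B := hB.differentiable (by simp)
  have hsmall : ∀ᶠ h : ℝ in 𝓝[>] 0, 0 < h ∧ h ≤ 1 := by
    filter_upwards [Ioc_mem_nhdsGT (zero_lt_one' ℝ)] with h hh using hh
  refine tendsto_integral_filter_of_dominated_convergence (fun z => L * 2 * ρ z) ?_ ?_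
    (hK.integrable.const_mul _) (ae_of_all _ fun z => ?_)
  · refine Eventually.of_forall fun h => hK.aestronglyMeasurable_weight.mul ?_
    exact Continuous.aestronglyMeasurable (by fun_prop)
  · filter_upwards [hsmall] with h hh
    refine ae_of_all _ fun z => hK.weight_mul_le (by positivity) fun hz => ?_
    have e := abs_sub_le_of_norm_fderiv_le hB hL hLB (x := (1 + h) • z) (y := z) (t := 2 * ‖z‖)
      (by linarith) (by
        rw [norm_smul, Real.norm_of_nonneg (by linarith)]
        nlinarith [norm_nonneg z]) (by linarith [norm_nonneg z])
    have e2 : (1 + h) • z - z = h • z := by rw [add_smul, one_smul]; abel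
    rw [e2, norm_smul, Real.norm_of_nonneg hh.1.le] at e
    rw [abs_mul, abs_of_pos (inv_pos.2 hh.1)]
    have h0 := hh.1
    calc h⁻¹ * |B ((1 + h) • z) - B z| ≤ h⁻¹ * (L * (2 * ‖z‖) * (h * ‖z‖)) := by gcongr
      _ = _ := by field_simp
  · have hder : HasDerivAt (fun h : ℝ => B ((1 + h) • z)) (fderiv ℝ B z z) 0 := by
      have h1 : HasDerivAt (fun h : ℝ => (1 + h) • z) ((1 : ℝ) • z) 0 :=
        ((hasDerivAt_id (0 : ℝ)).const_add 1).smul_const z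
      have h2 : HasFDerivAt B (fderiv ℝ B z) ((1 + (0 : ℝ)) • z) := by
        simpa using (hd z).hasFDerivAt
      have h5 := h2.comp_hasDerivAt (0 : ℝ) h1
      rw [one_smul] at h5
      exact h5
    have h3 := hder.tendsto_slope_zero_right
    have h4 : fderiv ℝ B z (kerVec ρ z) = weight ρ z * fderiv ℝ B z z := by
      rw [kerVec, map_smul, smul_eq_mul, weight]
    rw [h4]
    refine Tendsto.const_mul _ ?_
    simpa using h3

theorem IsCompactKernel.integrable_weight_mul (hK : IsCompactKernel ρ R)
    (hB : ContDiff ℝ (⊤ : ℕ∞) B) (hB0 : B 0 = 0) (hB' : fderiv ℝ B 0 = 0) {l : ℝ}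
    (hl : 0 ≤ l) : Integrable fun z => weight ρ z * B (l • z) := by
  obtain ⟨L, hL, hLB⟩ := exists_norm_fderiv_le hB hB' (l * R)
  have hBc := hB.continuous
  refine Integrable.mono' (hK.integrable.const_mul (L * l ^ 2)) ?_ (ae_of_all _ fun z => ?_)
  · exact hK.aestronglyMeasurable_weight.mul (Continuous.aestronglyMeasurable (by fun_prop))
  · refine hK.weight_mul_le (by positivity) fun hz => ?_
    have e0 : ‖l • z‖ = l * ‖z‖ := by rw [norm_smul, Real.norm_of_nonneg hl]
    have e := abs_sub_le_of_norm_fderiv_le hB hL hLB (x := l • z) (y := 0) (t := l * ‖z‖)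
      (by gcongr) e0.le (by rw [norm_zero]; positivity)
    rw [hB0, sub_zero, sub_zero, e0] at e
    exact e.trans_eq (by ring)

theorem IsCompactKernel.integral_quotient (hK : IsCompactKernel ρ R)
    (hB : ContDiff ℝ (⊤ : ℕ∞) B) (hB0 : B 0 = 0) (hB' : fderiv ℝ B 0 = 0) {l : ℝ}
    (hl : 0 < l) :
    Integrable (fun z => ((l ^ n)⁻¹ * weight ρ (l⁻¹ • z) - weight ρ z) * B z) ∧
    ∫ z, weight ρ z * (B (l • z) - B z) =
      ∫ z, ((l ^ n)⁻¹ * weight ρ (l⁻¹ • z) - weight ρ z) * B z := by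
  have i1 := hK.integrable_weight_mul hB hB0 hB' hl.le
  have i2 := hK.integrable_weight_mul hB hB0 hB' zero_le_one
  simp only [one_smul] at i2
  have e : (fun z => weight ρ z * B (l • z)) =
      fun z => (fun y => weight ρ (l⁻¹ • y) * B y) (l • z) := by
    ext1 z; simp only [inv_smul_smul₀ hl.ne']
  have i3 : Integrable fun y => (l ^ n)⁻¹ * (weight ρ (l⁻¹ • y) * B y) := by
    rw [e] at i1
    exact ((integrable_comp_smul_iff volume _ hl.ne').1 i1).const_mul _
  have e3 : ∫ z, weight ρ z * B (l • z) = ∫ y, (l ^ n)⁻¹ * (weight ρ (l⁻¹ • y) * B y) := by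
    rw [e, Measure.integral_comp_smul_of_nonneg volume (fun y => weight ρ (l⁻¹ • y) * B y) l
      (hR := hl.le), integral_const_mul]
    simp
  have e4 : (fun z => ((l ^ n)⁻¹ * weight ρ (l⁻¹ • z) - weight ρ z) * B z) =
      fun z => (l ^ n)⁻¹ * (weight ρ (l⁻¹ • z) * B z) - weight ρ z * B z := by
    ext1 z; ring
  rw [e4]
  refine ⟨i3.sub i2, ?_⟩
  rw [integral_sub i3 i2, ← e3, ← integral_sub i1 i2]
  simp only [mul_sub]

end Limit

/-- Coercivity of the dilation form `B ↦ ∫ DB(z) ρ(z) z / |z|² dz`. -/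
theorem exists_dilation_form_lower (hn : 0 < n) {ρ : Eu n → ℝ} {ρb : ℝ → ℝ} {ε R : ℝ}
    (h0 : IsKernelH0 n ρ ρb ε)
    (hK : IsCompactKernel ρ R) (h1 : IsKernelH1 n ρb ε) (h2 : IsKernelH2 n ρb ε)
    (h3 : IsKernelH3 n ρb ε) :
    ∃ s ∈ Ioo (0 : ℝ) 1, ∃ c > 0, ∃ C ≥ 0, ∀ r' : ℝ, 0 < r' → r' ≤ ε / 2 →
      ∀ (B : Eu n → ℝ) (m : ℝ), ContDiff ℝ (⊤ : ℕ∞) B → B 0 = 0 → fderiv ℝ B 0 = 0 →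
        (∀ z, 0 ≤ B z) → (∀ z, B z ≤ m) →
        c * r' ^ (-(1 + s)) * (∫ z, eta r' z * B z) - C * m ≤ ∫ z, fderiv ℝ B z (kerVec ρ z) := by
  obtain ⟨s, hs, c, hc, C, hC, hlow⟩ := exists_weight_dilate_lower hn h0 hK h1 h2 h3
  refine ⟨s, hs, c, hc, C * volume.real (closedBall (0 : Eu n) (2 * R)), by positivity, ?_⟩
  intro r' hr0 hr' B m hB hB0 hB' hBn hBm
  have hη := isTest_eta (n := n) hr0
  have hBc := hB.continuous
  refine ge_of_tendsto (hK.tendsto_quotient hB hB') ?_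
  filter_upwards [Ioc_mem_nhdsGT (zero_lt_one' ℝ)] with h hh
  obtain ⟨hi, he⟩ := hK.integral_quotient hB hB0 hB' (l := 1 + h) (by linarith [hh.1])
  have hh0 := hh.1
  have e1 : ∫ z, weight ρ z * (h⁻¹ * (B ((1 + h) • z) - B z)) =
      h⁻¹ * ∫ z, weight ρ z * (B ((1 + h) • z) - B z) := by
    rw [← integral_const_mul]
    congr 1; ext1 z; ring
  have i1 : Integrable fun z : Eu n => eta r' z * B z :=
    (hη.continuous.mul hBc).integrable_of_hasCompactSupport hη.hasCompactSupport.mul_right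
  have i2 : Integrable fun z : Eu n => (closedBall (0 : Eu n) (2 * R)).indicator (1 : Eu n → ℝ) z :=
    (integrable_indicator_iff measurableSet_closedBall).2
      (integrableOn_const (isCompact_closedBall _ _).measure_lt_top.ne)
  have e2 : c * r' ^ (-(1 + s)) * (∫ z, eta r' z * B z) -
      C * volume.real (closedBall (0 : Eu n) (2 * R)) * m =
      ∫ z, (c * r' ^ (-(1 + s)) * (eta r' z * B z) -
        C * m * (closedBall (0 : Eu n) (2 * R)).indicator (1 : Eu n → ℝ) z) := by
    rw [integral_sub (i1.const_mul _) (i2.const_mul _), integral_const_mul, integral_const_mul,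
      integral_indicator_one measurableSet_closedBall]
    ring
  rw [e1, he, e2, ← integral_const_mul]
  refine integral_mono ((i1.const_mul _).sub (i2.const_mul _)) (hi.const_mul _) fun z => ?_
  simp only []
  have hind : 0 ≤ (closedBall (0 : Eu n) (2 * R)).indicator (1 : Eu n → ℝ) z :=
    indicator_nonneg (fun _ _ => zero_le_one) z
  have hm : 0 ≤ m := (hBn 0).trans (hBm 0)
  rcases eq_or_ne z 0 with rfl | hz
  · rw [hB0]
    have : 0 ≤ C * m * (closedBall (0 : Eu n) (2 * R)).indicator (1 : Eu n → ℝ) 0 := by positivity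
    simp only [mul_zero, zero_sub]
    linarith
  · have e3 := hlow h r' hh.1 hh.2 hr0 hr' z hz
    have e4 : C * (closedBall (0 : Eu n) (2 * R)).indicator (1 : Eu n → ℝ) z * B z ≤
        C * (closedBall (0 : Eu n) (2 * R)).indicator (1 : Eu n → ℝ) z * m := by
      gcongr; exact hBm z
    calc _ ≤ (c * r' ^ (-(1 + s)) * eta r' z -
          C * (closedBall (0 : Eu n) (2 * R)).indicator (1 : Eu n → ℝ) z) * B z := by
          linarith
      _ = h⁻¹ * (h * (c * r' ^ (-(1 + s)) * eta r' z -
          C * (closedBall (0 : Eu n) (2 * R)).indicator (1 : Eu n → ℝ) z) * B z) := by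
          field_simp
      _ ≤ _ := by
          have := hBn z
          gcongr

end NonlocalPoincare

namespace NonlocalPoincare

open Filter Topology

theorem rpow_eq_rpow_sub_one_mul {N p : ℝ} (hN : 0 ≤ N) (hp : 1 < p) :
    N ^ p = N ^ (p - 1) * N := by
  have := Real.rpow_add_one' hN (y := p - 1) (by linarith)
  rwa [sub_add_cancel] at this

section Step

variable {ρ : Eu n → ℝ} {R p q : ℝ}

theorem corr_dualMap_le (hpq : p.HolderConjugate q) {v g : Eu n → ℝ} (hv : Continuous v)
    (hvc : HasCompactSupport v) (hg : Continuous g) (hgc : HasCompactSupport g) (z : Eu n) :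
    |corr (fun x => dualMap p (v x)) g z| ≤ pNorm p v ^ (p - 1) * pNorm p g := by
  have hp := hpq.lt
  have hΦ : Continuous fun x => dualMap p (v x) := (continuous_dualMap hp).comp hv
  have hΦc := hasCompactSupport_dualMap hp hvc
  rw [abs_le', ← pNorm_dualMap hpq]
  refine ⟨correlation_le hpq hΦ hΦc hg hgc z, ?_⟩
  have := correlation_le hpq hΦ hΦc hg.neg hgc.neg z
  simpa [corr, pNorm, integral_neg] using this

theorem IsCompactKernel.abs_integral_fderiv_moll_nlGradS_le (hK : IsCompactKernel ρ R)
    (hpq : p.HolderConjugate q) {k w F : Eu n → ℝ} (hk : IsTest k) (hw : IsTest w)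
    (hF : Continuous F) (hFc : HasCompactSupport F) :
    ∫ y, fderiv ℝ (moll k F) y (nlGradS ρ w y) ≤
      (∫ t, ‖fderiv ℝ k t‖) * (pNorm p (nlGradS ρ w) * pNorm q F) := by
  have hD := hK.continuous_nlGradS hw
  have hDc := hK.hasCompactSupport_nlGradS hw
  have hk' := hk.continuous_fderiv.norm
  have hkc' : HasCompactSupport fun t => ‖fderiv ℝ k t‖ :=
    (hk.hasCompactSupport.fderiv (𝕜 := ℝ)).norm
  have key := integral_mul_moll_le hpq.symm hD.norm hDc.norm hk' hkc'
    (fun _ => norm_nonneg _) hF.norm hFc.norm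
  rw [pNorm_norm, pNorm_norm] at key
  refine le_trans (integral_mono ?_ ?_ fun y => ?_) key
  · have h1 : Continuous (fderiv ℝ (moll k F)) :=
      (contDiff_moll hk.contDiff hk.hasCompactSupport hF).continuous_fderiv (by simp)
    refine (h1.clm_apply hD).integrable_of_hasCompactSupport ?_
    refine HasCompactSupport.intro hDc.isCompact fun y hy => ?_
    rw [image_eq_zero_of_notMem_tsupport hy, map_zero]
  · exact (hD.norm.mul (continuous_moll hk' hkc' hF.norm)).integrable_of_hasCompactSupport
      hDc.norm.mul_right
  · refine (Real.le_norm_self _).trans ((ContinuousLinearMap.le_opNorm _ _).trans ?_)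
    rw [mul_comm]
    exact mul_le_mul_of_nonneg_left (norm_fderiv_moll_le hk hF y) (norm_nonneg _)

theorem IsCompactKernel.integral_fderiv_corr (hK : IsCompactKernel ρ R) {F w : Eu n → ℝ}
    (hF : IsTest F) (hw : IsTest w) (h0 : fderiv ℝ (corr F w) 0 = 0) :
    ∫ z, fderiv ℝ (corr F w) z (kerVec ρ z) = -∫ y, fderiv ℝ F y (nlGradS ρ w y) := by
  rw [hK.integral_apply_nlGradS hw hF.continuous_fderiv, ← integral_neg]
  congr 1; ext1 z
  have hFc := hF.continuous_fderiv
  have hwc := hw.continuous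
  have e0 : ∫ y, w y * fderiv ℝ F y (kerVec ρ z) = 0 := by
    have := fderiv_corr hF hw 0 (kerVec ρ z)
    simpa [h0] using this.symm
  have hs : HasCompactSupport fun y => fderiv ℝ F y (kerVec ρ z) :=
    hF.hasCompactSupport.fderiv_apply (𝕜 := ℝ) _
  simp only [smul_eq_mul, sub_mul]
  rw [fderiv_corr hF hw, integral_sub, e0, zero_sub, neg_neg]
  · exact Continuous.integrable_of_hasCompactSupport (by fun_prop) hs.mul_left
  · exact Continuous.integrable_of_hasCompactSupport (by fun_prop) hs.mul_left

/-- Comparison of two mollification scales. -/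
theorem exists_scale_step (hn : 0 < n) {ρb : ℝ → ℝ} {ε : ℝ} (hpq : p.HolderConjugate q)
    (h0 : IsKernelH0 n ρ ρb ε)
    (hK : IsCompactKernel ρ R) (h1 : IsKernelH1 n ρb ε) (h2 : IsKernelH2 n ρb ε)
    (h3 : IsKernelH3 n ρb ε) :
    ∃ s ∈ Ioo (0 : ℝ) 1, ∃ C₁ ≥ 0, ∃ C₂ ≥ 0, ∀ r r' : ℝ, 0 < r → 0 < r' → r' ≤ ε / 2 →
      ∀ w : Eu n → ℝ, IsTest w → pNorm p (moll (eta r) w) ≤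
        pNorm p (moll (eta r') (moll (eta r) w)) +
          r' ^ (1 + s) * (C₁ / r * pNorm p (nlGradS ρ w) + C₂ * pNorm p (moll (eta r) w)) := by
  obtain ⟨s, hs, c, hc, C, hC, hlow⟩ := exists_dilation_form_lower hn h0 hK h1 h2 h3
  set A : ℝ := ∫ x : Eu n, ‖fderiv ℝ eta1 x‖ with hA
  have hA0 : 0 ≤ A := integral_nonneg fun _ => norm_nonneg _
  refine ⟨s, hs, A / c, by positivity, 2 * C / c, by positivity, ?_⟩
  intro r r' hr hr0 hr' w hw
  have hp := hpq.lt
  have hη := isTest_eta (n := n) hr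
  have hη' := isTest_eta (n := n) hr0
  have hv := hη.moll hw
  set v := moll (eta r) w with hvdef
  set Φ : Eu n → ℝ := fun x => dualMap p (v x) with hΦdef
  have hΦ : Continuous Φ := (continuous_dualMap hp).comp hv.continuous
  have hΦc : HasCompactSupport Φ := hasCompactSupport_dualMap hp hv.hasCompactSupport
  have hΘ : IsTest (moll (eta r) Φ) :=
    ⟨contDiff_moll hη.contDiff hη.hasCompactSupport hΦ,
      hasCompactSupport_moll hη.hasCompactSupport hΦc⟩
  have hcorr : corr Φ v = corr (moll (eta r) Φ) w :=
    corr_moll hη.continuous hη.hasCompactSupport eta_neg hΦ hΦc hw.continuous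
      hw.hasCompactSupport
  set N := pNorm p v with hN
  have hN0 : 0 ≤ N := pNorm_nonneg _ _
  have hNp : N ^ p = N ^ (p - 1) * N := rpow_eq_rpow_sub_one_mul hN0 hp
  set B : Eu n → ℝ := fun z => N ^ p - corr Φ v z with hBdef
  have hcs : ContDiff ℝ (⊤ : ℕ∞) (corr Φ v) := by rw [hcorr]; exact contDiff_corr hΘ hw
  have hB : ContDiff ℝ (⊤ : ℕ∞) B := contDiff_const.sub hcs
  have hbound : ∀ z, |corr Φ v z| ≤ N ^ p := fun z => by
    rw [hNp]
    exact corr_dualMap_le hpq hv.continuous hv.hasCompactSupport hv.continuous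
      hv.hasCompactSupport z
  have hB0 : B 0 = 0 := by
    simp only [hBdef, corr, sub_zero, hΦdef]
    rw [integral_dualMap_mul_self hp, sub_self]
  have hBn : ∀ z, 0 ≤ B z := fun z => by linarith [(abs_le.1 (hbound z)).2]
  have hBm : ∀ z, B z ≤ 2 * N ^ p := fun z => by
    simp only [hBdef]
    linarith [(abs_le.1 (hbound z)).1]
  have hB' : fderiv ℝ B 0 = 0 := by
    refine IsLocalMin.fderiv_eq_zero (Eventually.of_forall fun z => ?_)
    rw [hB0]; exact hBn z
  have hfd : ∀ z, fderiv ℝ B z = -fderiv ℝ (corr Φ v) z := fun z => by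
    rw [hBdef, fderiv_const_sub]
  have hc0 : fderiv ℝ (corr (moll (eta r) Φ) w) 0 = 0 := by
    rw [← hcorr, ← neg_eq_zero, ← hfd, hB']
  have key := hlow r' hr0 hr' B (2 * N ^ p) hB hB0 hB' hBn hBm
  have e1 : ∫ z, fderiv ℝ B z (kerVec ρ z) =
      ∫ y, fderiv ℝ (moll (eta r) Φ) y (nlGradS ρ w y) := by
    simp only [hfd, _root_.neg_apply, integral_neg]
    rw [hcorr, hK.integral_fderiv_corr hΘ hw hc0, neg_neg]
  have e2 := hK.abs_integral_fderiv_moll_nlGradS_le hpq hη hw hΦ hΦc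
  rw [integral_norm_fderiv_eta hr, pNorm_dualMap hpq] at e2
  have e3 : ∫ z, eta r' z * B z = N ^ p - ∫ x, Φ x * moll (eta r') v x := by
    rw [integral_mul_moll hΦ hΦc hη'.continuous hη'.hasCompactSupport hv.continuous]
    simp only [hBdef, mul_sub]
    rw [integral_sub, integral_mul_const, integral_eta hr0, one_mul]
    · rfl
    · exact (hη'.continuous.integrable_of_hasCompactSupport hη'.hasCompactSupport).mul_const _
    · exact integrable_mul_correlation hΦ hΦc hη'.continuous hη'.hasCompactSupport hv.continuous
  have e4 : ∫ x, Φ x * moll (eta r') v x ≤ N ^ (p - 1) * pNorm p (moll (eta r') v) := by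
    have hm := hη'.moll hv
    have := (abs_le.1 (corr_dualMap_le hpq hv.continuous hv.hasCompactSupport hm.continuous
      hm.hasCompactSupport 0)).2
    simpa only [corr, sub_zero] using this
  rw [e1, e3] at key
  refine le_of_rpow_le (p := p) hN0 ?_ ?_
  · have := pNorm_nonneg p (nlGradS ρ w)
    have := pNorm_nonneg p (moll (eta r') v)
    positivity
  set t := r' ^ (1 + s) with ht
  have ht0 : 0 < t := Real.rpow_pos_of_pos hr0 _
  rw [Real.rpow_neg hr0.le, ← ht] at key
  have key2 : c * t⁻¹ * (N ^ p - N ^ (p - 1) * pNorm p (moll (eta r') v)) - C * (2 * N ^ p) ≤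
      A / r * (pNorm p (nlGradS ρ w) * N ^ (p - 1)) := by
    refine le_trans ?_ (key.trans e2)
    gcongr
  have key3 : N ^ p - N ^ (p - 1) * pNorm p (moll (eta r') v) ≤
      t / c * (A / r * (pNorm p (nlGradS ρ w) * N ^ (p - 1)) + C * (2 * N ^ p)) := by
    have h5 := mul_le_mul_of_nonneg_left (sub_le_iff_le_add.1 key2)
      (by positivity : 0 ≤ t / c)
    refine le_trans (le_of_eq ?_) h5
    field_simp
  calc N ^ p ≤ N ^ (p - 1) * pNorm p (moll (eta r') v) +
        t / c * (A / r * (pNorm p (nlGradS ρ w) * N ^ (p - 1)) + C * (2 * N ^ p)) := by linarith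
    _ = _ := by
        rw [hNp]
        field_simp

end Step

theorem moll_left_comm {k k' w : Eu n → ℝ} (hk : IsTest k) (hk' : IsTest k')
    (hw : Continuous w) : moll k (moll k' w) = moll k' (moll k w) := by
  ext1 x
  have hkc := hk.continuous
  have hkc' := hk'.continuous
  have hint : Integrable (Function.uncurry fun t u => k t * (k' u * w (x - t - u)))
      (volume.prod volume) := by
    refine Continuous.integrable_of_hasCompactSupport
      (f := Function.uncurry fun t u => k t * (k' u * w (x - t - u))) ?_ ?_
    · unfold Function.uncurry
      fun_prop
    · refine HasCompactSupport.intro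
        (hk.hasCompactSupport.isCompact.prod hk'.hasCompactSupport.isCompact) ?_
      rintro ⟨t, u⟩ h
      simp only [mem_prod, not_and_or] at h
      rcases h with h | h
      · simp [Function.uncurry, image_eq_zero_of_notMem_tsupport h]
      · simp [Function.uncurry, image_eq_zero_of_notMem_tsupport h]
  calc moll k (moll k' w) x = ∫ t, ∫ u, k t * (k' u * w (x - t - u)) := by
        simp only [moll, ← integral_const_mul]
    _ = ∫ u, ∫ t, k t * (k' u * w (x - t - u)) := integral_integral_swap hint
    _ = _ := by
        simp only [moll, ← integral_const_mul]
        congr 1; ext1 u; congr 1; ext1 t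
        rw [sub_right_comm]; ring

theorem pNorm_le_of_bound {F : Type*} [NormedAddCommGroup F] {p : ℝ} (hp : 0 < p)
    {f : Eu n → F} {b r : ℝ} (hb : 0 ≤ b) (hf : ∀ x, ‖f x‖ ≤ b) (hr : ∀ x, r < ‖x‖ → f x = 0) :
    pNorm p f ≤ b * volume.real (closedBall (0 : Eu n) r) ^ (1 / p) := by
  have i : Integrable fun z : Eu n =>
      b ^ p * (closedBall (0 : Eu n) r).indicator (1 : Eu n → ℝ) z :=
    ((integrable_indicator_iff measurableSet_closedBall).2
      (integrableOn_const (isCompact_closedBall _ _).measure_lt_top.ne)).const_mul _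
  have h : ∫ x, ‖f x‖ ^ p ≤ b ^ p * volume.real (closedBall (0 : Eu n) r) := by
    rw [← integral_indicator_one measurableSet_closedBall, ← integral_const_mul]
    refine integral_mono_of_nonneg (ae_of_all _ fun _ => Real.rpow_nonneg (norm_nonneg _) _) i
      (ae_of_all _ fun x => ?_)
    simp only []
    by_cases hx : r < ‖x‖
    · rw [hr x hx, norm_zero, Real.zero_rpow hp.ne']
      exact mul_nonneg (Real.rpow_nonneg hb _) (indicator_nonneg (fun _ _ => zero_le_one) _)
    · rw [indicator_of_mem (by simpa using hx), Pi.one_apply, mul_one]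
      exact Real.rpow_le_rpow (norm_nonneg _) (hf x) hp.le
  calc pNorm p f ≤ (b ^ p * volume.real (closedBall (0 : Eu n) r)) ^ (1 / p) :=
        Real.rpow_le_rpow (integral_nonneg fun _ => Real.rpow_nonneg (norm_nonneg _) _) h
          (by positivity)
    _ = _ := by
        rw [Real.mul_rpow (by positivity) (by positivity), ← Real.rpow_mul hb,
          mul_one_div_cancel hp.ne', Real.rpow_one]

theorem abs_moll_eta_sub_le {w : Eu n → ℝ} (hw : IsTest w) {L r : ℝ} (hr : 0 < r) (hL0 : 0 ≤ L)
    (hL : ∀ x y, |w x - w y| ≤ L * ‖x - y‖) (x : Eu n) : |w x - moll (eta r) w x| ≤ L * r := by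
  have hη := isTest_eta (n := n) hr
  have hi := hη.continuous.integrable_of_hasCompactSupport (μ := volume) hη.hasCompactSupport
  have e : w x - moll (eta r) w x = ∫ t, eta r t * (w x - w (x - t)) := by
    simp only [mul_sub]
    rw [integral_sub (hi.mul_const _)
      (integrable_conv hη.continuous hη.hasCompactSupport hw.continuous x), integral_mul_const,
      integral_eta hr, one_mul, moll]
  rw [e, ← Real.norm_eq_abs]
  refine (norm_integral_le_integral_norm _).trans ?_
  calc ∫ t, ‖eta r t * (w x - w (x - t))‖ ≤ ∫ t : Eu n, eta r t * (L * r) := by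
        refine integral_mono_of_nonneg (ae_of_all _ fun _ => norm_nonneg _) (hi.mul_const _)
          (ae_of_all _ fun t => ?_)
        simp only [norm_mul, Real.norm_of_nonneg (eta_nonneg hr t)]
        rcases lt_or_ge ‖t‖ r with h | h
        · have h1 := hL x (x - t)
          rw [sub_sub_cancel] at h1
          refine mul_le_mul_of_nonneg_left (h1.trans ?_) (eta_nonneg hr t)
          gcongr
        · rw [eta_eq_zero hr h, zero_mul, zero_mul]
    _ = L * r := by rw [integral_mul_const, integral_eta hr, one_mul]

theorem moll_eta_eq_zero {w : Eu n → ℝ} {r b : ℝ} (hr : 0 < r) (hw : ∀ x, b < ‖x‖ → w x = 0)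
    {x : Eu n} (hx : b + r < ‖x‖) : moll (eta r) w x = 0 := by
  rw [moll]
  refine integral_eq_zero_of_ae (ae_of_all _ fun t => ?_)
  simp only [Pi.zero_apply]
  rcases lt_or_ge ‖t‖ r with h | h
  · have : ‖x‖ ≤ ‖x - t‖ + ‖t‖ := by simpa using norm_add_le (x - t) t
    rw [hw (x - t) (by linarith), mul_zero]
  · rw [eta_eq_zero hr h, zero_mul]

/-- A function is controlled in `L^p` by its mollifications at scales tending to zero. -/
theorem pNorm_le_of_forall_moll {p q : ℝ} (hpq : p.HolderConjugate q) {w : Eu n → ℝ}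
    (hw : IsTest w) {u : ℕ → ℝ} (hu0 : ∀ k, 0 < u k) (hu1 : ∀ k, u k ≤ 1)
    (hu : Tendsto u atTop (𝓝 0)) {T : ℝ} (hT : ∀ k, pNorm p (moll (eta (u k)) w) ≤ T) :
    pNorm p w ≤ T := by
  obtain ⟨L, hL0, hL⟩ := hw.exists_lipschitz
  obtain ⟨b, -, hb⟩ := exists_radius hw.hasCompactSupport
  set V := volume.real (closedBall (0 : Eu n) (b + 1)) ^ (1 / p)
  have hlim : Tendsto (fun k => T + L * u k * V) atTop (𝓝 (T + L * 0 * V)) :=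
    tendsto_const_nhds.add ((hu.const_mul L).mul_const V)
  rw [mul_zero, zero_mul, add_zero] at hlim
  refine ge_of_tendsto' hlim fun k => ?_
  have hm := (isTest_eta (n := n) (hu0 k)).moll hw
  have h1 := pNorm_add_le hpq hm.continuous hm.hasCompactSupport
    (hw.continuous.sub hm.continuous) (hw.hasCompactSupport.sub hm.hasCompactSupport)
  have h2 : (fun x => moll (eta (u k)) w x + (w - moll (eta (u k)) w) x) = w := by
    ext1 x; simp
  have h3 : pNorm p (w - moll (eta (u k)) w) ≤ L * u k * V := by
    refine pNorm_le_of_bound hpq.pos (mul_nonneg hL0 (hu0 k).le)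
      (fun x => abs_moll_eta_sub_le hw (hu0 k) hL0 hL x) fun x hx => ?_
    have := hu1 k
    rw [Pi.sub_apply, hb x (by linarith), moll_eta_eq_zero (hu0 k) hb (by linarith), sub_zero]
  rw [h2] at h1
  linarith [hT k]

end NonlocalPoincare

namespace NonlocalPoincare

open Filter Topology

section Iterate

variable {ρ : Eu n → ℝ} {R p q : ℝ}

theorem IsCompactKernel.pNorm_moll_scale_le (hK : IsCompactKernel ρ R)
    (hpq : p.HolderConjugate q) {s C₁ C₂ δ r₀ : ℝ} (hC₁ : 0 ≤ C₁)
    (hC₂ : 0 ≤ C₂)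
    (hstep : ∀ r r' : ℝ, 0 < r → 0 < r' → r' ≤ δ →
      ∀ w : Eu n → ℝ, IsTest w → pNorm p (moll (eta r) w) ≤
        pNorm p (moll (eta r') (moll (eta r) w)) +
          r' ^ (1 + s) * (C₁ / r * pNorm p (nlGradS ρ w) + C₂ * pNorm p (moll (eta r) w)))
    (hr₀ : 0 < r₀) (hr₀' : r₀ ≤ δ) (k : ℕ) : ∀ w : Eu n → ℝ, IsTest w →
      pNorm p (moll (eta (r₀ * (1 / 2) ^ k)) w) ≤ pNorm p (moll (eta r₀) w) +
        (∑ i ∈ Finset.range k, ((1 / 2 : ℝ) ^ s) ^ i) *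
          (2 * C₁ * r₀ ^ s * pNorm p (nlGradS ρ w) + C₂ * r₀ ^ (1 + s) * pNorm p w) := by
  induction k with
  | zero => intro w _; simp
  | succ k ih =>
    intro w hw
    set r := r₀ * (1 / 2) ^ (k + 1) with hr
    set r' := r₀ * (1 / 2) ^ k with hr'
    have hr0 : 0 < r := by positivity
    have hr'0 : 0 < r' := by positivity
    have hrr : r' = 2 * r := by rw [hr, hr', pow_succ]; ring
    have hle : r' ≤ r₀ := mul_le_of_le_one_right hr₀.le (pow_le_one₀ (by norm_num) (by norm_num))
    have hη := isTest_eta (n := n) hr0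
    have hη₀ := isTest_eta (n := n) hr₀
    have hv := hη.moll hw
    have s1 := hstep r r' hr0 hr'0 (hle.trans hr₀') w hw
    have s2 := ih (moll (eta r) w) hv
    have s3 : pNorm p (moll (eta r₀) (moll (eta r) w)) ≤ pNorm p (moll (eta r₀) w) := by
      rw [moll_left_comm hη₀ hη hw.continuous]
      refine (pNorm_moll_le hpq hη.continuous hη.hasCompactSupport (eta_nonneg hr0)
        (hη₀.moll hw).continuous (hη₀.moll hw).hasCompactSupport).trans_eq ?_
      rw [integral_eta hr0, one_mul]
    have s4 : pNorm p (moll (eta r) w) ≤ pNorm p w := by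
      refine (pNorm_moll_le hpq hη.continuous hη.hasCompactSupport (eta_nonneg hr0)
        hw.continuous hw.hasCompactSupport).trans_eq ?_
      rw [integral_eta hr0, one_mul]
    have s5 := hK.pNorm_nlGradS_moll_le hpq hη (eta_nonneg hr0) (integral_eta hr0) hw
    have hD := pNorm_nonneg p (nlGradS ρ w)
    have hW := pNorm_nonneg p w
    set θ : ℝ := (1 / 2 : ℝ) ^ s with hθ
    have hθ0 : 0 ≤ θ := by positivity
    have hsum : 0 ≤ ∑ i ∈ Finset.range k, θ ^ i := Finset.sum_nonneg fun _ _ => by positivity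
    have hrs : r' ^ s = r₀ ^ s * θ ^ k := by
      rw [hr', Real.mul_rpow hr₀.le (by positivity), hθ, ← Real.rpow_natCast,
        ← Real.rpow_natCast, ← Real.rpow_mul (by norm_num), ← Real.rpow_mul (by norm_num),
        mul_comm s]
    have hr1s : r' ^ (1 + s) = r' * (r₀ ^ s * θ ^ k) := by
      rw [Real.rpow_add hr'0, Real.rpow_one, hrs]
    have hr01s : r₀ ^ (1 + s) = r₀ * r₀ ^ s := by
      rw [Real.rpow_add hr₀, Real.rpow_one]
    have hr₀s : 0 ≤ r₀ ^ s := by positivity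
    rw [Finset.sum_range_succ]
    calc _ ≤ _ := s1
      _ ≤ (pNorm p (moll (eta r₀) w) + (∑ i ∈ Finset.range k, θ ^ i) *
          (2 * C₁ * r₀ ^ s * pNorm p (nlGradS ρ w) + C₂ * r₀ ^ (1 + s) * pNorm p w)) +
          r' ^ (1 + s) * (C₁ / r * pNorm p (nlGradS ρ w) + C₂ * pNorm p w) := by
          have : pNorm p (moll (eta r') (moll (eta r) w)) ≤ pNorm p (moll (eta r₀) w) +
              (∑ i ∈ Finset.range k, θ ^ i) *
              (2 * C₁ * r₀ ^ s * pNorm p (nlGradS ρ w) + C₂ * r₀ ^ (1 + s) * pNorm p w) := by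
            refine s2.trans (add_le_add s3 ?_)
            gcongr
          gcongr
      _ = (pNorm p (moll (eta r₀) w) + (∑ i ∈ Finset.range k, θ ^ i) *
          (2 * C₁ * r₀ ^ s * pNorm p (nlGradS ρ w) + C₂ * r₀ ^ (1 + s) * pNorm p w)) +
          θ ^ k * (2 * C₁ * r₀ ^ s * pNorm p (nlGradS ρ w) +
            C₂ * (r' * r₀ ^ s) * pNorm p w) := by
          rw [hr1s, hrr]
          field_simp
      _ ≤ (pNorm p (moll (eta r₀) w) + (∑ i ∈ Finset.range k, θ ^ i) *
          (2 * C₁ * r₀ ^ s * pNorm p (nlGradS ρ w) + C₂ * r₀ ^ (1 + s) * pNorm p w)) +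
          θ ^ k * (2 * C₁ * r₀ ^ s * pNorm p (nlGradS ρ w) +
            C₂ * r₀ ^ (1 + s) * pNorm p w) := by
          rw [hr01s]
          gcongr
      _ = _ := by ring

/-- Control of a function by one fixed mollification, its nonlocal gradient and a small
multiple of itself. -/
theorem exists_moll_bound (hn : 0 < n) {ρb : ℝ → ℝ} {ε : ℝ} (hpq : p.HolderConjugate q)
    (h0 : IsKernelH0 n ρ ρb ε)
    (hK : IsCompactKernel ρ R) (h1 : IsKernelH1 n ρb ε) (h2 : IsKernelH2 n ρb ε)
    (h3 : IsKernelH3 n ρb ε) :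
    ∃ r > 0, ∃ C ≥ 0, ∀ w : Eu n → ℝ, IsTest w →
      pNorm p w ≤ pNorm p (moll (eta r) w) + C * pNorm p (nlGradS ρ w) + 1 / 4 * pNorm p w := by
  obtain ⟨s, hs, C₁, hC₁, C₂, hC₂, hstep⟩ := exists_scale_step hn hpq h0 hK h1 h2 h3
  have hε : 0 < ε := h0.2.2.2.2.1
  set θ : ℝ := (1 / 2 : ℝ) ^ s with hθ
  have hθ0 : 0 ≤ θ := by positivity
  have hθ1 : θ < 1 := Real.rpow_lt_one (by norm_num) (by norm_num) hs.1
  have hθ2 : 0 < 1 - θ := by linarith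
  set r₀ : ℝ := min (min 1 (ε / 2)) ((1 - θ) / (4 * (C₂ + 1))) with hr₀
  have hr₀0 : 0 < r₀ := by positivity
  have hr₀1 : r₀ ≤ 1 := (min_le_left _ _).trans (min_le_left _ _)
  have hr₀ε : r₀ ≤ ε / 2 := (min_le_left _ _).trans (min_le_right _ _)
  have hr₀θ : r₀ ≤ (1 - θ) / (4 * (C₂ + 1)) := min_le_right _ _
  refine ⟨r₀, hr₀0, (1 - θ)⁻¹ * (2 * C₁ * r₀ ^ s), by positivity, fun w hw => ?_⟩
  have hD := pNorm_nonneg p (nlGradS ρ w)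
  have hW := pNorm_nonneg p w
  have hpow : r₀ ^ (1 + s) ≤ r₀ := by
    have := Real.rpow_le_rpow_of_exponent_ge hr₀0 hr₀1 (by linarith [hs.1] : 1 ≤ 1 + s)
    rwa [Real.rpow_one] at this
  have hsmall : (1 - θ)⁻¹ * (C₂ * r₀ ^ (1 + s)) ≤ 1 / 4 := by
    rw [inv_mul_le_iff₀ hθ2]
    have h5 : r₀ * (4 * (C₂ + 1)) ≤ 1 - θ := (le_div_iff₀ (by positivity)).1 hr₀θ
    have h6 : C₂ * r₀ ^ (1 + s) ≤ C₂ * r₀ := by gcongr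
    linarith
  refine pNorm_le_of_forall_moll hpq hw (u := fun k => r₀ * (1 / 2) ^ k) (fun k => by positivity)
    (fun k => ?_) ?_ fun k => ?_
  · exact mul_le_one₀ hr₀1 (by positivity) (pow_le_one₀ (by norm_num) (by norm_num))
  · simpa using (tendsto_pow_atTop_nhds_zero_of_lt_one (r := (1 / 2 : ℝ)) (by norm_num)
      (by norm_num)).const_mul r₀
  · refine (hK.pNorm_moll_scale_le hpq hC₁ hC₂ hstep hr₀0 hr₀ε k w hw).trans ?_
    have hgeom : ∑ i ∈ Finset.range k, θ ^ i ≤ (1 - θ)⁻¹ := by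
      rw [← tsum_geometric_of_lt_one hθ0 hθ1]
      exact (summable_geometric_of_lt_one hθ0 hθ1).sum_le_tsum _ fun _ _ => by positivity
    rw [add_assoc]
    gcongr
    calc _ ≤ (1 - θ)⁻¹ *
          (2 * C₁ * r₀ ^ s * pNorm p (nlGradS ρ w) + C₂ * r₀ ^ (1 + s) * pNorm p w) := by
          gcongr
      _ = (1 - θ)⁻¹ * (2 * C₁ * r₀ ^ s) * pNorm p (nlGradS ρ w) +
          (1 - θ)⁻¹ * (C₂ * r₀ ^ (1 + s)) * pNorm p w := by ring
      _ ≤ _ := by gcongr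

end Iterate
end NonlocalPoincare

namespace NonlocalPoincare
open Filter Topology

theorem exists_integral_norm_le {p q : ℝ} (hpq : p.HolderConjugate q) (F : Type*)
    [NormedAddCommGroup F] (b : ℝ) :
    ∃ V > 0, ∀ f : Eu n → F, Continuous f → (∀ x, b < ‖x‖ → f x = 0) →
      ∫ x, ‖f x‖ ≤ V * pNorm p f := by
  set g : Eu n → ℝ := fun x => max 0 (min 1 (b + 1 - ‖x‖)) with hg
  have hgc : Continuous g := by fun_prop
  have hgs : HasCompactSupport g := hasCompactSupport_of_radius (r := b + 1) fun x hx => by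
    simp only [hg]
    rw [max_eq_left]
    exact (min_le_right _ _).trans (by linarith)
  refine ⟨pNorm q g + 1, by linarith [pNorm_nonneg q g], fun f hf hb => ?_⟩
  have h := integral_mul_le_pNorm hpq hf (hasCompactSupport_of_radius hb) hgc hgs
  have e : (fun x => ‖f x‖ * ‖g x‖) = fun x => ‖f x‖ := by
    ext x
    by_cases hx : b < ‖x‖
    · simp [hb x hx]
    · have : g x = 1 := by
        simp only [hg]
        rw [min_eq_left (by linarith), max_eq_right zero_le_one]
      simp [this]
  rw [e] at h
  nlinarith [pNorm_nonneg p f, pNorm_nonneg q g]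

section Exponentials

variable {ρ : Eu n → ℝ} {R : ℝ}

theorem abs_exp_sub_one_le (t : ℝ) : |Real.exp t - 1| ≤ |t| * Real.exp |t| := by
  have h1 := Real.add_one_le_exp t
  have h2 := Real.add_one_le_exp (-t)
  have h3 : Real.exp (-t) * Real.exp t = 1 := by rw [← Real.exp_add]; simp
  have h4 := Real.exp_pos t
  rcases le_total 0 t with ht | ht
  · rw [abs_of_nonneg ht, abs_of_nonneg (by linarith)]
    nlinarith
  · have h5 : 1 ≤ Real.exp |t| := Real.one_le_exp (abs_nonneg t)
    have h6 : Real.exp t ≤ 1 := Real.exp_le_one_iff.2 ht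
    rw [abs_of_nonpos (by linarith : Real.exp t - 1 ≤ 0)]
    have : -t = |t| := (abs_of_nonpos ht).symm
    nlinarith [abs_nonneg t]

/-- The factor by which the pairing with an exponential acts on the nonlocal gradient. -/
def expSymbol (ρ : Eu n → ℝ) (a : Eu n) : ℝ :=
  ∫ z, (Real.exp ⟪a, z⟫_ℝ - 1) * ⟪a, kerVec ρ z⟫_ℝ

theorem inner_kerVec (a z : Eu n) : ⟪a, kerVec ρ z⟫_ℝ = ρ z / ‖z‖ ^ 2 * ⟪a, z⟫_ℝ := by
  rw [kerVec, real_inner_smul_right]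

theorem mul_exp_sub_one_nonneg (t : ℝ) : 0 ≤ (Real.exp t - 1) * t := by
  rcases le_total 0 t with ht | ht
  · exact mul_nonneg (by linarith [Real.one_le_exp ht]) ht
  · exact mul_nonneg_of_nonpos_of_nonpos (by linarith [Real.exp_le_one_iff.2 ht]) ht

theorem IsCompactKernel.expSymbol_pos (hK : IsCompactKernel ρ R) {ε c : ℝ} (hε : 0 < ε)
    (hc : 0 < c) (hρ : ∀ x ∈ closedBall (0 : Eu n) ε, x ≠ 0 → c ≤ ρ x) {a : Eu n} (ha : a ≠ 0) :
    0 < expSymbol ρ a := by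
  have hform : ∀ z, (Real.exp ⟪a, z⟫_ℝ - 1) * ⟪a, kerVec ρ z⟫_ℝ =
      ρ z / ‖z‖ ^ 2 * ((Real.exp ⟪a, z⟫_ℝ - 1) * ⟪a, z⟫_ℝ) := fun z => by
    rw [inner_kerVec]; ring
  have hi : Integrable fun z => (Real.exp ⟪a, z⟫_ℝ - 1) * ⟪a, kerVec ρ z⟫_ℝ := by
    refine Integrable.mono' (hK.integrable.const_mul (‖a‖ * Real.exp (‖a‖ * R) * ‖a‖)) ?_
      (ae_of_all _ fun z => ?_)
    · have h1 : Continuous fun z : Eu n => Real.exp ⟪a, z⟫_ℝ - 1 := by fun_prop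
      exact h1.aestronglyMeasurable.mul
        (hK.aestronglyMeasurable_kerVec.const_inner)
    · by_cases hz : R < ‖z‖
      · simp [kerVec_eq_zero (hK.eq_zero z hz), hK.eq_zero z hz]
      · have hin : |⟪a, z⟫_ℝ| ≤ ‖a‖ * ‖z‖ := abs_real_inner_le_norm a z
        have hR : ‖a‖ * ‖z‖ ≤ ‖a‖ * R := by gcongr; linarith
        rw [norm_mul, Real.norm_eq_abs, Real.norm_eq_abs]
        calc _ ≤ (‖a‖ * ‖z‖ * Real.exp (‖a‖ * R)) * (‖a‖ * ‖kerVec ρ z‖) := by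
              gcongr
              · refine (abs_exp_sub_one_le _).trans ?_
                gcongr
                exact hin.trans hR
              · exact abs_real_inner_le_norm a _
          _ = ‖a‖ * Real.exp (‖a‖ * R) * ‖a‖ * (‖z‖ * ‖kerVec ρ z‖) := by ring
          _ ≤ _ := by gcongr; exact hK.norm_mul_norm_kerVec_le z
  rw [expSymbol, integral_pos_iff_support_of_nonneg (fun z => ?_) hi]
  · have hopen : IsOpen (ball (0 : Eu n) ε ∩ {z | 0 < ⟪a, z⟫_ℝ}) :=
      isOpen_ball.inter (isOpen_lt continuous_const (by fun_prop))
    have ha' : 0 < ‖a‖ := norm_pos_iff.2 ha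
    have hne : (ball (0 : Eu n) ε ∩ {z | 0 < ⟪a, z⟫_ℝ}).Nonempty := by
      refine ⟨(ε / 2 * ‖a‖⁻¹) • a, ?_, ?_⟩
      · rw [mem_ball_zero_iff, norm_smul, Real.norm_of_nonneg (by positivity), mul_assoc,
          inv_mul_cancel₀ ha'.ne']
        linarith
      · simp only [mem_ofPred_eq, real_inner_smul_right, real_inner_self_eq_norm_sq]
        positivity
    refine (hopen.measure_pos volume hne).trans_le (measure_mono fun z hz => ?_)
    have hz2 : 0 < ⟪a, z⟫_ℝ := hz.2
    have hz0 : z ≠ 0 := by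
      rintro rfl
      simp at hz2
    rw [Function.mem_support, hform]
    have h1 : 0 < ρ z := hc.trans_le (hρ z (ball_subset_closedBall hz.1) hz0)
    have h2 : 1 < Real.exp ⟪a, z⟫_ℝ := Real.one_lt_exp_iff.2 hz2
    have h3 : 0 < ‖z‖ := norm_pos_iff.2 hz0
    have h4 : 0 < Real.exp ⟪a, z⟫_ℝ - 1 := by linarith
    positivity
  · simp only [Pi.zero_apply]
    rw [hform]
    exact mul_nonneg (div_nonneg (hK.nonneg z) (by positivity)) (mul_exp_sub_one_nonneg _)

theorem IsCompactKernel.integral_exp_inner_nlGradS (hK : IsCompactKernel ρ R) {w : Eu n → ℝ}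
    (hw : IsTest w) (a : Eu n) :
    ∫ x, Real.exp ⟪a, x⟫_ℝ * ⟪a, nlGradS ρ w x⟫_ℝ =
      -(expSymbol ρ a * ∫ x, Real.exp ⟪a, x⟫_ℝ * w x) := by
  have hwc := hw.continuous
  have hψ : Continuous fun x : Eu n => Real.exp ⟪a, x⟫_ℝ • innerSL ℝ a := by fun_prop
  have h := hK.integral_apply_nlGradS hw hψ
  simp only [_root_.smul_apply, innerSL_apply_apply, smul_eq_mul] at h
  rw [h, expSymbol, ← neg_mul, ← integral_neg, ← integral_mul_const]
  congr 1; ext1 z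
  have i : ∀ y : Eu n, Integrable fun x => Real.exp ⟪a, x⟫_ℝ * w (x - y) := fun y =>
    Continuous.integrable_of_hasCompactSupport (by fun_prop)
      ((hw.hasCompactSupport.comp_homeomorph (Homeomorph.subRight y)).mul_left)
  have i0 : Integrable fun x => Real.exp ⟪a, x⟫_ℝ * w x := by simpa using i 0
  have e : ∫ x, Real.exp ⟪a, x⟫_ℝ * w (x - z) =
      Real.exp ⟪a, z⟫_ℝ * ∫ x, Real.exp ⟪a, x⟫_ℝ * w x := by
    rw [← integral_add_right_eq_self _ z, ← integral_const_mul]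
    congr 1; ext1 x
    rw [add_sub_cancel_right, inner_add_right, Real.exp_add]
    ring
  calc _ = ∫ x, (Real.exp ⟪a, x⟫_ℝ * w x - Real.exp ⟪a, x⟫_ℝ * w (x - z)) *
        ⟪a, kerVec ρ z⟫_ℝ := by
        congr 1; ext1 x; ring
    _ = _ := by
        rw [integral_mul_const, integral_sub i0 (i z), e]
        ring

end Exponentials

section Controlled

variable {ρ : Eu n → ℝ} {R p q b : ℝ}

/-- The pairings of `g` with test functions supported in the ball of radius `b` are controlled
by the nonlocal gradient, up to an arbitrarily small multiple of the function itself. -/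
def IsControlled (p : ℝ) (ρ : Eu n → ℝ) (b : ℝ) (g : Eu n → ℝ) : Prop :=
  ∀ κ > 0, ∃ C ≥ 0, ∀ w : Eu n → ℝ, IsTest w → (∀ x, b < ‖x‖ → w x = 0) →
    |∫ x, g x * w x| ≤ κ * pNorm p w + C * pNorm p (nlGradS ρ w)

theorem integrable_mul_isTest {g w : Eu n → ℝ} (hg : Continuous g) (hw : IsTest w) :
    Integrable fun x => g x * w x :=
  (hg.mul hw.continuous).integrable_of_hasCompactSupport hw.hasCompactSupport.mul_left

theorem IsControlled.zero : IsControlled p ρ b 0 := fun κ hκ =>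
  ⟨0, le_rfl, fun w _ _ => by simpa using mul_nonneg hκ.le (pNorm_nonneg p w)⟩

theorem IsControlled.add {g h : Eu n → ℝ} (hgc : Continuous g) (hhc : Continuous h)
    (hg : IsControlled p ρ b g) (hh : IsControlled p ρ b h) : IsControlled p ρ b (g + h) := by
  intro κ hκ
  obtain ⟨C, hC, H⟩ := hg (κ / 2) (by positivity)
  obtain ⟨C', hC', H'⟩ := hh (κ / 2) (by positivity)
  refine ⟨C + C', by positivity, fun w hw hb => ?_⟩
  simp only [Pi.add_apply, add_mul]
  rw [integral_add (integrable_mul_isTest hgc hw) (integrable_mul_isTest hhc hw)]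
  refine (abs_add_le _ _).trans ?_
  linarith [H w hw hb, H' w hw hb]

theorem IsControlled.const_smul {g : Eu n → ℝ} (hg : IsControlled p ρ b g) (c : ℝ) :
    IsControlled p ρ b (c • g) := by
  intro κ hκ
  obtain ⟨C, hC, H⟩ := hg (κ / (|c| + 1)) (by positivity)
  refine ⟨|c| * C, by positivity, fun w hw hb => ?_⟩
  simp only [Pi.smul_apply, smul_eq_mul, mul_assoc]
  rw [integral_const_mul, abs_mul]
  have h1 : |c| * (κ / (|c| + 1)) ≤ κ := by
    rw [← mul_div_assoc, div_le_iff₀ (by positivity)]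
    nlinarith [abs_nonneg c]
  calc _ ≤ |c| * (κ / (|c| + 1) * pNorm p w + C * pNorm p (nlGradS ρ w)) := by
        gcongr; exact H w hw hb
    _ = |c| * (κ / (|c| + 1)) * pNorm p w + |c| * (C * pNorm p (nlGradS ρ w)) := by ring
    _ ≤ _ := by gcongr; exact pNorm_nonneg p w

theorem abs_integral_mul_le_of_near {V : ℝ} (hV : ∀ f : Eu n → ℝ, Continuous f →
      (∀ x, b < ‖x‖ → f x = 0) → ∫ x, ‖f x‖ ≤ V * pNorm p f)
    {g h w : Eu n → ℝ} {δ : ℝ} (hδ : 0 ≤ δ) (hg : Continuous g) (hh : Continuous h)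
    (hgh : ∀ x, ‖x‖ ≤ b → |h x - g x| ≤ δ) (hw : IsTest w) (hb : ∀ x, b < ‖x‖ → w x = 0) :
    |∫ x, g x * w x| ≤ |∫ x, h x * w x| + δ * (V * pNorm p w) := by
  have i1 := integrable_mul_isTest hg hw
  have i2 := integrable_mul_isTest hh hw
  have hd : |(∫ x, h x * w x) - ∫ x, g x * w x| ≤ δ * (V * pNorm p w) := by
    rw [← integral_sub i2 i1, ← Real.norm_eq_abs]
    calc _ ≤ ∫ x, δ * ‖w x‖ := by
          refine norm_integral_le_of_norm_le
            ((hw.continuous.integrable_of_hasCompactSupport hw.hasCompactSupport).norm.const_mul δ)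
            (ae_of_all _ fun x => ?_)
          rw [← sub_mul, norm_mul]
          by_cases hx : b < ‖x‖
          · simp [hb x hx]
          · gcongr
            exact hgh x (not_lt.1 hx)
      _ ≤ _ := by
          rw [integral_const_mul]
          gcongr
          exact hV w hw.continuous hb
  have := abs_sub_abs_le_abs_sub (∫ x, g x * w x) (∫ x, h x * w x)
  rw [abs_sub_comm] at this
  linarith

theorem IsControlled.of_near (hpq : p.HolderConjugate q) {g : Eu n → ℝ} (hg : Continuous g)
    (H : ∀ δ > 0, ∃ h : Eu n → ℝ, Continuous h ∧ IsControlled p ρ b h ∧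
      ∀ x, ‖x‖ ≤ b → |h x - g x| ≤ δ) : IsControlled p ρ b g := by
  obtain ⟨V, hV0, hV⟩ := exists_integral_norm_le (n := n) hpq ℝ b
  intro κ hκ
  obtain ⟨h, hhc, hh, hgh⟩ := H (κ / 2 / V) (by positivity)
  obtain ⟨C, hC, hCw⟩ := hh (κ / 2) (by positivity)
  refine ⟨C, hC, fun w hw hb => ?_⟩
  have h1 := abs_integral_mul_le_of_near hV (by positivity) hg hhc hgh hw hb
  have h2 : κ / 2 / V * (V * pNorm p w) = κ / 2 * pNorm p w := by field_simp
  linarith [hCw w hw hb]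

theorem IsCompactKernel.isControlled_exp (hK : IsCompactKernel ρ R) (hpq : p.HolderConjugate q)
    {a : Eu n} (ha : 0 < expSymbol ρ a) :
    IsControlled p ρ b fun x => Real.exp ⟪a, x⟫_ℝ := by
  intro κ hκ
  obtain ⟨V, hV0, hV⟩ := exists_integral_norm_le (n := n) hpq (Eu n) (b + R)
  refine ⟨(expSymbol ρ a)⁻¹ * (Real.exp (‖a‖ * (b + R)) * ‖a‖ * V), by positivity,
    fun w hw hb => ?_⟩
  have hD := hK.continuous_nlGradS hw
  have hDs := hK.hasCompactSupport_nlGradS hw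
  have hb' : |∫ x, Real.exp ⟪a, x⟫_ℝ * ⟪a, nlGradS ρ w x⟫_ℝ| ≤
      Real.exp (‖a‖ * (b + R)) * ‖a‖ * V * pNorm p (nlGradS ρ w) := by
    rw [← Real.norm_eq_abs]
    calc _ ≤ ∫ x, Real.exp (‖a‖ * (b + R)) * ‖a‖ * ‖nlGradS ρ w x‖ := by
          refine norm_integral_le_of_norm_le
            ((hD.integrable_of_hasCompactSupport hDs).norm.const_mul _)
            (ae_of_all _ fun x => ?_)
          by_cases hx : b + R < ‖x‖
          · simp [hK.nlGradS_eq_zero hb hx]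
          · rw [norm_mul, Real.norm_of_nonneg (Real.exp_pos _).le, mul_assoc]
            gcongr
            · refine (real_inner_le_norm a x).trans ?_
              gcongr
              exact not_lt.1 hx
            · exact norm_inner_le_norm a _
      _ ≤ _ := by
          rw [integral_const_mul, mul_assoc _ V]
          gcongr
          exact hV _ hD fun x hx => hK.nlGradS_eq_zero hb hx
  rw [hK.integral_exp_inner_nlGradS hw, abs_neg, abs_mul, abs_of_pos ha] at hb'
  have h1 := (le_inv_mul_iff₀ ha).2 hb'
  have h2 := mul_nonneg hκ.le (pNorm_nonneg p w)
  linarith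

theorem IsCompactKernel.isControlled_one (hn : 0 < n) (hK : IsCompactKernel ρ R)
    (hpq : p.HolderConjugate q) (ha : ∀ a : Eu n, a ≠ 0 → 0 < expSymbol ρ a) :
    IsControlled p ρ b fun _ => 1 := by
  refine IsControlled.of_near hpq continuous_const fun δ hδ => ?_
  obtain ⟨v, hv⟩ : ∃ v : Eu n, v ≠ 0 := by
    have : Nonempty (Fin n) := ⟨⟨0, hn⟩⟩
    exact exists_ne 0
  have hlim : Tendsto (fun t : ℝ => |t| * ‖v‖ * |b| * Real.exp (|t| * ‖v‖ * |b|)) (𝓝[>] 0)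
      (𝓝 0) := by
    have : Continuous fun t : ℝ => |t| * ‖v‖ * |b| * Real.exp (|t| * ‖v‖ * |b|) := by fun_prop
    have h := this.tendsto 0
    simp only [abs_zero, zero_mul] at h
    exact h.mono_left nhdsWithin_le_nhds
  obtain ⟨t, ht, ht0⟩ := ((hlim.eventually_le_const hδ).and self_mem_nhdsWithin).exists
  refine ⟨fun x => Real.exp ⟪t • v, x⟫_ℝ, by fun_prop,
    hK.isControlled_exp hpq (ha _ (smul_ne_zero (ne_of_gt ht0) hv)), fun x hx => ?_⟩
  refine (abs_exp_sub_one_le _).trans (le_trans ?_ ht)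
  have : |⟪t • v, x⟫_ℝ| ≤ |t| * ‖v‖ * |b| := by
    refine (abs_real_inner_le_norm _ _).trans ?_
    rw [norm_smul, Real.norm_eq_abs]
    gcongr
    exact hx.trans (le_abs_self b)
  gcongr

/-- The exponential function with exponent `a` as a continuous map. -/
def expMap (a : Eu n) : C(Eu n, ℝ) := ⟨fun x => Real.exp ⟪a, x⟫_ℝ, by fun_prop⟩

theorem expMap_mem_closure {g : C(Eu n, ℝ)}
    (hg : g ∈ Submonoid.closure (range (expMap : Eu n → C(Eu n, ℝ)))) : ∃ a, g = expMap a := by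
  induction hg using Submonoid.closure_induction with
  | mem x hx => exact hx.imp fun _ h => h.symm
  | one => exact ⟨0, by ext x; simp [expMap]⟩
  | mul x y _ _ hx hy =>
    obtain ⟨a, rfl⟩ := hx
    obtain ⟨a', rfl⟩ := hy
    exact ⟨a + a', by ext x; simp [expMap, inner_add_left, Real.exp_add]⟩

theorem IsCompactKernel.isControlled (hn : 0 < n) (hK : IsCompactKernel ρ R)
    (hpq : p.HolderConjugate q) (ha : ∀ a : Eu n, a ≠ 0 → 0 < expSymbol ρ a) {g : Eu n → ℝ}
    (hg : Continuous g) : IsControlled p ρ b g := by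
  refine IsControlled.of_near hpq hg fun δ hδ => ?_
  set A : Subalgebra ℝ C(Eu n, ℝ) := Algebra.adjoin ℝ (range expMap) with hA
  have hsep : A.SeparatesPoints := by
    intro x y hxy
    refine ⟨expMap (x - y), ⟨expMap (x - y), Algebra.subset_adjoin (mem_range_self _), rfl⟩, ?_⟩
    intro h
    have h' : Real.exp ⟪x - y, x⟫_ℝ = Real.exp ⟪x - y, y⟫_ℝ := h
    have h2 := Real.exp_injective h'
    rw [← sub_eq_zero, ← inner_sub_right, inner_self_eq_zero, sub_eq_zero] at h2
    exact hxy h2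
  obtain ⟨h, hh, hn'⟩ :=
    ContinuousMap.exists_mem_subalgebra_near_continuous_of_isCompact_of_separatesPoints hsep
      ⟨g, hg⟩ (isCompact_closedBall (0 : Eu n) b) hδ
  refine ⟨h, h.continuous, ?_, fun x hx => (hn' x (by simpa using hx)).le⟩
  have hmem : h ∈ Submodule.span ℝ
      (Submonoid.closure (range (expMap : Eu n → C(Eu n, ℝ))) : Set C(Eu n, ℝ)) := by
    rw [← Algebra.adjoin_eq_span]
    exact hh
  clear hn' hh
  induction hmem using Submodule.span_induction with
  | mem x hx =>
    obtain ⟨a, rfl⟩ := expMap_mem_closure hx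
    rcases eq_or_ne a 0 with rfl | ha0
    · simpa [expMap] using hK.isControlled_one hn hpq ha
    · exact hK.isControlled_exp hpq (ha a ha0)
  | zero => exact IsControlled.zero
  | add x y _ _ hx hy => exact hx.add x.continuous y.continuous hy
  | smul c x _ hx => exact hx.const_smul c

theorem IsCompactKernel.exists_moll_le (hn : 0 < n) (hK : IsCompactKernel ρ R)
    (hpq : p.HolderConjugate q) (ha : ∀ a : Eu n, a ≠ 0 → 0 < expSymbol ρ a) {r κ : ℝ}
    (hr : 0 < r) (hκ : 0 < κ) :
    ∃ C ≥ 0, ∀ w : Eu n → ℝ, IsTest w → (∀ x, b < ‖x‖ → w x = 0) → ∀ x,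
      |moll (eta r) w x| ≤ κ * pNorm p w + C * pNorm p (nlGradS ρ w) := by
  obtain ⟨V, hV0, hV⟩ := exists_integral_norm_le (n := n) hpq ℝ b
  have hη := isTest_eta (n := n) hr
  have hηc := hη.continuous
  have huc : UniformContinuous (eta r : Eu n → ℝ) :=
    hη.hasCompactSupport.uniformContinuous_of_continuous hηc
  obtain ⟨δ, hδ, hδη⟩ := Metric.uniformContinuous_iff.1 huc (κ / 2 / V) (by positivity)
  obtain ⟨t, -, htf, htc⟩ :=
    (isCompact_closedBall (0 : Eu n) (b + r)).finite_cover_balls hδ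
  have hctrl : ∀ y : Eu n, IsControlled p ρ b fun x => eta r (y - x) := fun y =>
    hK.isControlled hn hpq ha (by fun_prop)
  choose C hC0 hC using fun y => hctrl y (κ / 2) (by positivity)
  refine ⟨∑ y ∈ htf.toFinset, C y, Finset.sum_nonneg fun y _ => hC0 y, fun w hw hb x => ?_⟩
  have hD := pNorm_nonneg p (nlGradS ρ w)
  by_cases hx : b + r < ‖x‖
  · rw [moll_eta_eq_zero hr hb hx, abs_zero]
    have := Finset.sum_nonneg fun y (_ : y ∈ htf.toFinset) => hC0 y
    have := pNorm_nonneg p w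
    positivity
  · obtain ⟨y, hyt, hxy⟩ : ∃ y ∈ t, x ∈ ball y δ := by
      have := htc (show x ∈ closedBall (0 : Eu n) (b + r) by simpa using hx)
      simpa using this
    rw [moll_swap]
    have h1 := abs_integral_mul_le_of_near hV (δ := κ / 2 / V) (by positivity)
      (g := fun z => eta r (x - z)) (h := fun z => eta r (y - z)) (by fun_prop) (by fun_prop)
      (fun z _ => by
        rw [← Real.dist_eq]
        refine (hδη ?_).le
        rw [dist_sub_right, dist_comm]
        exact hxy) hw hb
    have h2 : κ / 2 / V * (V * pNorm p w) = κ / 2 * pNorm p w := by field_simp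
    have h3 : C y * pNorm p (nlGradS ρ w) ≤
        (∑ y ∈ htf.toFinset, C y) * pNorm p (nlGradS ρ w) := by
      gcongr
      exact Finset.single_le_sum (fun y _ => hC0 y) (htf.mem_toFinset.2 hyt)
    linarith [hC y w hw hb]

/-- The nonlocal Poincaré inequality for test functions supported in a fixed ball. -/
theorem exists_poincare (hn : 0 < n) {ρb : ℝ → ℝ} {ε : ℝ} (hpq : p.HolderConjugate q)
    (h0 : IsKernelH0 n ρ ρb ε) (hK : IsCompactKernel ρ R) (h1 : IsKernelH1 n ρb ε)
    (h2 : IsKernelH2 n ρb ε) (h3 : IsKernelH3 n ρb ε) (b : ℝ) :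
    ∃ C > 0, ∀ w : Eu n → ℝ, IsTest w → (∀ x, b < ‖x‖ → w x = 0) →
      pNorm p w ≤ C * pNorm p (nlGradS ρ w) := by
  obtain ⟨r, hr, C₁, hC₁, H₁⟩ := exists_moll_bound hn hpq h0 hK h1 h2 h3
  obtain ⟨-, -, -, -, hε, c, hc, hρ⟩ := h0
  set V := volume.real (closedBall (0 : Eu n) (b + r)) ^ (1 / p) with hVdef
  have hV : 0 ≤ V := by positivity
  obtain ⟨C₂, hC₂, H₂⟩ := hK.exists_moll_le (b := b) (κ := 1 / 4 / (V + 1)) hn hpq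
    (fun a ha => hK.expSymbol_pos hε hc hρ ha) hr (by positivity)
  refine ⟨2 * (C₁ + C₂ * V) + 1, by positivity, fun w hw hb => ?_⟩
  have hD := pNorm_nonneg p (nlGradS ρ w)
  have hW := pNorm_nonneg p w
  have h4 := pNorm_le_of_bound (f := moll (eta r) w) hpq.pos (by positivity) (H₂ w hw hb)
    fun x hx => moll_eta_eq_zero hr hb hx
  rw [← hVdef] at h4
  have h5 : 1 / 4 / (V + 1) * V ≤ 1 / 4 := by
    rw [div_mul_eq_mul_div, div_le_iff₀ (by positivity)]
    linarith
  have h6 : 1 / 4 / (V + 1) * V * pNorm p w ≤ 1 / 4 * pNorm p w := by gcongr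
  have h7 := H₁ w hw
  nlinarith

theorem isCompactKernel_of_hasCompactSupport (hρ0 : ∀ x, 0 ≤ ρ x) (hρ : LocallyIntegrable ρ volume)
    (hsupp : HasCompactSupport ρ) : ∃ R, IsCompactKernel ρ R := by
  obtain ⟨R, hR, h⟩ := exists_radius hsupp
  refine ⟨R, hR, hρ0, ?_, h⟩
  rw [← integrableOn_iff_integrable_of_support_subset (subset_tsupport ρ)]
  exact hρ.integrableOn_isCompact hsupp

end Controlled
end NonlocalPoincare

variable (n)

/-- Poincaré inequality for nonlocal gradients with general kernels. -/
theorem stmt6 (hn : 0 < n) (p : ℝ) (hp : 1 < p) (ρ : Eu n → ℝ) (ρb : ℝ → ℝ) (ε : ℝ)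
    (h0 : IsKernelH0 n ρ ρb ε) (h1 : IsKernelH1 n ρb ε) (h2 : IsKernelH2 n ρb ε)
    (h3 : IsKernelH3 n ρb ε) (h4 : IsKernelH4 n ρb ε) (hsupp : HasCompactSupport ρ)
    (Ω : Set (Eu n)) (hΩo : IsOpen Ω) (hΩb : Bornology.IsBounded Ω) :
    ∃ c > (0 : ℝ), ∀ u : Eu n → ℝ, ContDiff ℝ (⊤ : ℕ∞) u → HasCompactSupport u → tsupport u ⊆ Ω →
      eLpNorm u (ENNReal.ofReal p) (volume.restrict Ω) ≤
        ENNReal.ofReal c * eLpNorm (nlGradS ρ u) (ENNReal.ofReal p) volume := by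
  obtain ⟨R, hK⟩ :=
    NonlocalPoincare.isCompactKernel_of_hasCompactSupport h0.1 h0.2.2.1 hsupp
  obtain ⟨b, hb⟩ := hΩb.subset_closedBall 0
  obtain ⟨C, hC, H⟩ := NonlocalPoincare.exists_poincare hn (Real.HolderConjugate.conjExponent hp)
    h0 hK h1 h2 h3 b
  refine ⟨C, hC, fun u hu huc huΩ => ?_⟩
  have hw : NonlocalPoincare.IsTest u := ⟨hu, huc⟩
  have hp0 : 0 < p := by linarith
  refine (eLpNorm_mono_measure u Measure.restrict_le_self).trans ?_
  rw [NonlocalPoincare.eLpNorm_eq_pNorm hp0 hw.continuous huc,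
    NonlocalPoincare.eLpNorm_eq_pNorm hp0 (hK.continuous_nlGradS hw)
      (hK.hasCompactSupport_nlGradS hw), ← ENNReal.ofReal_mul hC.le]
  refine ENNReal.ofReal_le_ofReal (H u hw fun x hx => ?_)
  refine image_eq_zero_of_notMem_tsupport fun hxu => ?_
  have := hb (huΩ hxu)
  rw [mem_closedBall_zero_iff] at this
  linarith
end
end

section
/- Let ρ satisfy (H0) and have compact support, let μ, λ ∈ ℝ, and define C[M] := 2μ M_sym + λ (tr M) I for M ∈ ℝ^{n×n}. Then for every v ∈ C_c^∞(ℝ^n; ℝ^n) and every x ∈ ℝ^n, all defining integrals converge absolutely and div_ρ ( C[(D_ρ v)_sym] )(x) = −μ (−Δ)_ρ v(x) + (μ + λ) D_ρ ( div_ρ v )(x), where (−Δ)_ρ v := −div_ρ (D_ρ v) componentwise. (The isotropic nonlocal Navier–Lamé decomposition.) -/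
open MeasureTheory Metric Set Matrix
open scoped ENNReal InnerProductSpace

noncomputable section

variable {n : ℕ}

/-- The increment operator `u ↦ ∫ (u(x) - u(y)) k(x - y) dy` with scalar kernel `k`. -/
def incrOp (k : Eu n → ℝ) (u : Eu n → ℝ) (x : Eu n) : ℝ :=
  ∫ y, (u x - u y) * k (x - y)

/-- The `j`-th component `z_j ρ(z) / |z|²` of the vector kernel of the nonlocal gradient. -/
def gradKer (ρ : Eu n → ℝ) (j : Fin n) (z : Eu n) : ℝ := z j * ρ z / ‖z‖ ^ 2

/-- Kernels with integrable first moment. -/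
def HasFirstMoment (k : Eu n → ℝ) : Prop :=
  AEStronglyMeasurable k volume ∧ Integrable (fun z => ‖z‖ * |k z|) volume

lemma hasFirstMoment_gradKer {ρ : Eu n → ℝ} (hρ : Integrable ρ volume) (j : Fin n) :
    HasFirstMoment (gradKer ρ j) := by
  have hm : AEStronglyMeasurable (gradKer ρ j) volume := by
    have h1 : Measurable fun z : Eu n => z j := by fun_prop
    have h2 : Measurable fun z : Eu n => ‖z‖ ^ 2 := by fun_prop
    exact ((h1.aemeasurable.mul hρ.aemeasurable).div h2.aemeasurable).aestronglyMeasurable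
  refine ⟨hm, hρ.mono ?_ (Filter.Eventually.of_forall fun z => ?_)⟩
  · exact (continuous_norm.aestronglyMeasurable).mul (by simpa using hm.norm)
  · have hz : |z j| ≤ ‖z‖ := by simpa using PiLp.norm_apply_le z j
    rcases eq_or_ne z 0 with rfl | hz0
    · simp
    · have hp : 0 < ‖z‖ := norm_pos_iff.2 hz0
      simp only [gradKer, Real.norm_eq_abs, abs_mul, abs_div, abs_abs, abs_norm, abs_pow]
      have : ‖z‖ * (|z j| * |ρ z| / ‖z‖ ^ 2) = (|z j| / ‖z‖) * |ρ z| := by field_simp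
      rw [this]
      exact mul_le_of_le_one_left (abs_nonneg _) ((div_le_one hp).2 hz)

lemma integrable_incr_shift {k u : Eu n → ℝ} (hk : HasFirstMoment k) {C : NNReal}
    (hu : LipschitzWith C u) (x : Eu n) :
    Integrable (fun z => (u x - u (x - z)) * k z) volume := by
  have hc : Continuous fun z => u x - u (x - z) :=
    continuous_const.sub (hu.continuous.comp (by fun_prop))
  refine (hk.2.const_mul (C : ℝ)).mono' (hc.aestronglyMeasurable.mul hk.1)
    (Filter.Eventually.of_forall fun z => ?_)
  have h := hu.dist_le_mul x (x - z)
  rw [Real.dist_eq, dist_eq_norm, sub_sub_cancel] at h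
  rw [Real.norm_eq_abs, abs_mul, ← mul_assoc]
  exact mul_le_mul_of_nonneg_right h (abs_nonneg _)

lemma integrable_incr {k u : Eu n → ℝ} (hk : HasFirstMoment k) {C : NNReal}
    (hu : LipschitzWith C u) (x : Eu n) :
    Integrable (fun y => (u x - u y) * k (x - y)) volume := by
  simpa using (integrable_incr_shift hk hu x).comp_sub_left x

lemma incrOp_eq_shift (k u : Eu n → ℝ) (x : Eu n) :
    incrOp k u x = ∫ z, (u x - u (x - z)) * k z := by
  rw [incrOp, ← integral_sub_left_eq_self (fun z => (u x - u (x - z)) * k z) volume x]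
  simp

/-- Second differences of a compactly supported smooth function are bounded bilinearly. -/
lemma exists_second_difference_le {u : Eu n → ℝ} (hu : ContDiff ℝ (⊤ : ℕ∞) u)
    (hus : HasCompactSupport u) :
    ∃ C : NNReal, ∀ x z w : Eu n,
      |(u x - u (x - z)) - (u (x - w) - u (x - w - z))| ≤ C * ‖z‖ * ‖w‖ := by
  have hd : ContDiff ℝ 1 (fderiv ℝ u) := hu.fderiv_right (by norm_cast)
  obtain ⟨C, hC⟩ := hd.lipschitzWith_of_hasCompactSupport (hus.fderiv ℝ) one_ne_zero
  refine ⟨C, fun x z w => ?_⟩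
  have hdu : Differentiable ℝ u := hu.differentiable (by simp)
  have hder : ∀ y, HasFDerivAt (fun y => u y - u (y - z))
      (fderiv ℝ u y - fderiv ℝ u (y - z)) y := fun y =>
    (hdu y).hasFDerivAt.sub ((hdu (y - z)).hasFDerivAt.comp y ((hasFDerivAt_id y).sub_const z))
  have h := Convex.norm_image_sub_le_of_norm_hasFDerivWithin_le (s := univ) (C := C * ‖z‖)
    (fun y _ => (hder y).hasFDerivWithinAt) (fun y _ => by
      simpa [dist_eq_norm] using hC.dist_le_mul y (y - z)) convex_univ
    (mem_univ (x - w)) (mem_univ x)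
  simpa using h

lemma lipschitz_incrOp {k u : Eu n → ℝ} (hk : HasFirstMoment k)
    (hu : ContDiff ℝ (⊤ : ℕ∞) u) (hus : HasCompactSupport u) :
    ∃ C : NNReal, LipschitzWith C (incrOp k u) := by
  obtain ⟨L, hL⟩ := hu.lipschitzWith_of_hasCompactSupport hus (by simp)
  obtain ⟨C, hC⟩ := exists_second_difference_le hu hus
  refine ⟨_, LipschitzWith.of_dist_le' (K := C * ∫ z, ‖z‖ * |k z|) fun x y => ?_⟩
  rw [incrOp_eq_shift, incrOp_eq_shift, dist_eq_norm,
    ← integral_sub (integrable_incr_shift hk hL x) (integrable_incr_shift hk hL y),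
    mul_right_comm, ← integral_const_mul]
  refine norm_integral_le_of_norm_le (hk.2.const_mul _) (Filter.Eventually.of_forall fun z => ?_)
  have h := hC x z (x - y)
  rw [sub_sub_cancel] at h
  rw [← sub_mul, Real.norm_eq_abs, abs_mul, dist_eq_norm]
  calc _ ≤ C * ‖z‖ * ‖x - y‖ * |k z| := mul_le_mul_of_nonneg_right h (abs_nonneg _)
    _ = _ := by ring

/-- Increment operators commute on compactly supported smooth functions. -/
lemma incrOp_comm {k l u : Eu n → ℝ} (hk : HasFirstMoment k) (hl : HasFirstMoment l)
    (hu : ContDiff ℝ (⊤ : ℕ∞) u) (hus : HasCompactSupport u) (x : Eu n) :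
    incrOp k (incrOp l u) x = incrOp l (incrOp k u) x := by
  obtain ⟨L, hL⟩ := hu.lipschitzWith_of_hasCompactSupport hus (by simp)
  obtain ⟨C, hC⟩ := exists_second_difference_le hu hus
  have expand : ∀ {k l : Eu n → ℝ}, HasFirstMoment l →
      incrOp k (incrOp l u) x =
        ∫ w, ∫ z, ((u x - u (x - z)) - (u (x - w) - u (x - w - z))) * (l z * k w) := by
    intro k l hl
    rw [incrOp_eq_shift]
    congr 1 with w
    rw [incrOp_eq_shift, incrOp_eq_shift,
      ← integral_sub (integrable_incr_shift hl hL x) (integrable_incr_shift hl hL (x - w)),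
      ← integral_mul_const]
    congr 1 with z
    ring
  rw [expand hl, expand hk, integral_integral_swap]
  · congr 1 with z
    congr 1 with w
    rw [sub_right_comm x w z]
    ring
  · have hcont : Continuous fun p : Eu n × Eu n =>
        (u x - u (x - p.2)) - (u (x - p.1) - u (x - p.1 - p.2)) := by
      have := hu.continuous
      fun_prop
    refine ((hk.2.mul_prod hl.2).const_mul (C : ℝ)).mono'
      (hcont.aestronglyMeasurable.mul (hl.1.comp_snd.mul hk.1.comp_fst))
      (Filter.Eventually.of_forall fun p => ?_)
    simp only [Function.uncurry, Real.norm_eq_abs, abs_mul]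
    calc _ ≤ C * ‖p.2‖ * ‖p.1‖ * (|l p.2| * |k p.1|) :=
          mul_le_mul_of_nonneg_right (hC x p.2 p.1) (by positivity)
      _ = _ := by ring

lemma incrOp_add {k u w : Eu n → ℝ} (hk : HasFirstMoment k) {C D : NNReal}
    (hu : LipschitzWith C u) (hw : LipschitzWith D w) (x : Eu n) :
    incrOp k (fun z => u z + w z) x = incrOp k u x + incrOp k w x := by
  rw [incrOp, incrOp, incrOp, ← integral_add (integrable_incr hk hu x) (integrable_incr hk hw x)]
  congr 1 with y
  ring

lemma incrOp_const_mul (k u : Eu n → ℝ) (c : ℝ) (x : Eu n) :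
    incrOp k (fun z => c * u z) x = c * incrOp k u x := by
  rw [incrOp, incrOp, ← integral_const_mul]
  congr 1 with y
  ring

lemma incrOp_sum {k : Eu n → ℝ} {u : Fin n → Eu n → ℝ} (hk : HasFirstMoment k)
    (hu : ∀ j, ∃ C : NNReal, LipschitzWith C (u j)) (x : Eu n) :
    incrOp k (fun z => ∑ j, u j z) x = ∑ j, incrOp k (u j) x := by
  choose C hC using hu
  simp only [incrOp]
  rw [← integral_finsetSum _ fun j _ => integrable_incr hk (hC j) x]
  congr 1 with y
  rw [← Finset.sum_sub_distrib, Finset.sum_mul]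

lemma exists_lipschitz_const_mul {u : Eu n → ℝ} (hu : ∃ C : NNReal, LipschitzWith C u) (c : ℝ) :
    ∃ C : NNReal, LipschitzWith C fun z => c * u z := by
  obtain ⟨C, hC⟩ := hu
  exact ⟨_, (lipschitzWith_smul c).comp hC⟩

lemma exists_lipschitz_add {u w : Eu n → ℝ} (hu : ∃ C : NNReal, LipschitzWith C u)
    (hw : ∃ C : NNReal, LipschitzWith C w) :
    ∃ C : NNReal, LipschitzWith C fun z => u z + w z := by
  obtain ⟨C, hC⟩ := hu
  obtain ⟨D, hD⟩ := hw
  exact ⟨_, hC.add hD⟩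

lemma exists_lipschitz_sum {u : Fin n → Eu n → ℝ}
    (hu : ∀ j, ∃ C : NNReal, LipschitzWith C (u j)) :
    ∃ C : NNReal, LipschitzWith C fun z => ∑ j, u j z := by
  refine Finset.sum_induction (s := Finset.univ) u (fun f => ∃ C : NNReal, LipschitzWith C f)
    (fun f g => exists_lipschitz_add) ⟨0, LipschitzWith.const 0⟩ (fun j _ => hu j) |>.imp
    fun C hC => ?_
  simpa only [Finset.sum_fn] using hC

lemma nlGradMInt_eq (ρ : Eu n → ℝ) (v : Eu n → Eu n) (x : Eu n) (i j : Fin n) :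
    nlGradMInt ρ v x i j = fun y => (v x i - v y i) * gradKer ρ j (x - y) := by
  ext y
  simp only [nlGradMInt, gradKer, PiLp.sub_apply]
  ring

lemma nlGradM_apply (ρ : Eu n → ℝ) (v : Eu n → Eu n) (x : Eu n) (i j : Fin n) :
    nlGradM ρ v x i j = incrOp (gradKer ρ j) (fun z => v z i) x := by
  simp only [nlGradM, Matrix.of_apply, nlGradMInt_eq, incrOp]

lemma nlDivVInt_eq (ρ : Eu n → ℝ) (v : Eu n → Eu n) (x : Eu n) :
    nlDivVInt ρ v x = fun y => ∑ j, (v x j - v y j) * gradKer ρ j (x - y) := by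
  ext y
  simp only [nlDivVInt, gradKer, PiLp.inner_apply, PiLp.sub_apply, Finset.sum_mul,
    Finset.sum_div, RCLike.inner_apply, conj_trivial]
  refine Finset.sum_congr rfl fun j _ => ?_
  ring

lemma nlDivMInt_eq (ρ : Eu n → ℝ) (Φ : Eu n → Matrix (Fin n) (Fin n) ℝ) (x : Eu n) (i : Fin n) :
    nlDivMInt ρ Φ x i = fun y => ∑ j, (Φ x i j - Φ y i j) * gradKer ρ j (x - y) := by
  ext y
  simp only [nlDivMInt, gradKer, PiLp.sub_apply, Finset.sum_mul, Finset.sum_div]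
  refine Finset.sum_congr rfl fun j _ => ?_
  ring

lemma integrable_nlDivMInt {ρ : Eu n → ℝ} (hρ : Integrable ρ volume)
    {Φ : Eu n → Matrix (Fin n) (Fin n) ℝ}
    (hΦ : ∀ i j, ∃ C : NNReal, LipschitzWith C fun z => Φ z i j) (x : Eu n) (i : Fin n) :
    Integrable (nlDivMInt ρ Φ x i) volume := by
  rw [nlDivMInt_eq]
  refine integrable_finsetSum _ fun j _ => ?_
  obtain ⟨C, hC⟩ := hΦ i j
  exact integrable_incr (hasFirstMoment_gradKer hρ j) hC x

lemma nlDivM_apply {ρ : Eu n → ℝ} (hρ : Integrable ρ volume)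
    {Φ : Eu n → Matrix (Fin n) (Fin n) ℝ}
    (hΦ : ∀ i j, ∃ C : NNReal, LipschitzWith C fun z => Φ z i j) (x : Eu n) (i : Fin n) :
    nlDivM ρ Φ x i = ∑ j, incrOp (gradKer ρ j) (fun z => Φ z i j) x := by
  choose C hC using hΦ
  change ∫ y, nlDivMInt ρ Φ x i y = _
  simp only [nlDivMInt_eq]
  exact integral_finsetSum _ fun j _ =>
    integrable_incr (hasFirstMoment_gradKer hρ j) (hC i j) x

lemma integrable_nlDivVInt {ρ : Eu n → ℝ} (hρ : Integrable ρ volume)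
    {v : Eu n → Eu n}
    (hv : ∀ i, ∃ C : NNReal, LipschitzWith C fun z => v z i) (x : Eu n) :
    Integrable (nlDivVInt ρ v x) volume := by
  rw [nlDivVInt_eq]
  refine integrable_finsetSum _ fun j _ => ?_
  obtain ⟨C, hC⟩ := hv j
  exact integrable_incr (hasFirstMoment_gradKer hρ j) hC x

lemma nlDivV_eq_sum {ρ : Eu n → ℝ} (hρ : Integrable ρ volume)
    {v : Eu n → Eu n}
    (hv : ∀ i, ∃ C : NNReal, LipschitzWith C fun z => v z i) (x : Eu n) :
    nlDivV ρ v x = ∑ j, incrOp (gradKer ρ j) (fun z => v z j) x := by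
  choose C hC using hv
  simp only [nlDivV, nlDivVInt_eq]
  exact integral_finsetSum _ fun j _ =>
    integrable_incr (hasFirstMoment_gradKer hρ j) (hC j) x

lemma integrable_nlGradSInt {ρ : Eu n → ℝ} (hρ : Integrable ρ volume)
    {u : Eu n → ℝ} (hu : ∃ C : NNReal, LipschitzWith C u) (x : Eu n) :
    Integrable (fun y => ((u x - u y) * ρ (x - y) / ‖x - y‖ ^ 2) • (x - y)) volume := by
  obtain ⟨C, hC⟩ := hu
  refine Integrable.of_eval_piLp fun j => ?_
  refine (integrable_incr (hasFirstMoment_gradKer hρ j) hC x).congr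
    (Filter.Eventually.of_forall fun y => ?_)
  simp only [gradKer, PiLp.smul_apply, smul_eq_mul]
  ring

lemma nlGradS_apply {ρ : Eu n → ℝ} (hρ : Integrable ρ volume)
    {u : Eu n → ℝ} (hu : ∃ C : NNReal, LipschitzWith C u) (x : Eu n)
    (i : Fin n) : nlGradS ρ u x i = incrOp (gradKer ρ i) u x := by
  have h := (EuclideanSpace.proj (𝕜 := ℝ) i).integral_comp_comm (integrable_nlGradSInt hρ hu x)
  rw [nlGradS, incrOp]
  refine h.symm.trans ?_
  congr 1 with y
  change (u x - u y) * ρ (x - y) / ‖x - y‖ ^ 2 * (x - y) i = _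
  rw [gradKer]
  ring

lemma isoC_symPart_apply (μ lam : ℝ) (M : Matrix (Fin n) (Fin n) ℝ) (i j : Fin n) :
    isoC μ lam (symPart M) i j =
      (μ * M i j + μ * M j i) + (lam * (1 : Matrix (Fin n) (Fin n) ℝ) i j) * ∑ k, M k k := by
  have ht : (symPart M).trace = ∑ k, M k k := by
    simp only [symPart, Matrix.trace_smul, Matrix.trace_add, Matrix.trace_transpose,
      smul_eq_mul]
    rw [Matrix.trace]
    simp only [Matrix.diag_apply]
    ring
  rw [isoC, ht]
  simp only [Matrix.add_apply, Matrix.smul_apply, symPart, Matrix.transpose_apply, smul_eq_mul]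
  ring

variable (n)

/-- the isotropic nonlocal Navier–Lamé decomposition. -/
theorem stmt8 (hn : 0 < n) (ρ : Eu n → ℝ) (ρb : ℝ → ℝ) (ε : ℝ)
    (h0 : IsKernelH0 n ρ ρb ε) (hsupp : HasCompactSupport ρ) (μ lam : ℝ)
    (v : Eu n → Eu n) (hv : ContDiff ℝ (⊤ : ℕ∞) v) (hvs : HasCompactSupport v) (x : Eu n) :
    (∀ i j, Integrable (nlGradMInt ρ v x i j) volume) ∧
    Integrable (nlDivVInt ρ v x) volume ∧
    (∀ i, Integrable
      (nlDivMInt ρ (fun z => isoC μ lam (symPart (nlGradM ρ v z))) x i) volume) ∧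
    (∀ i, Integrable (nlDivMInt ρ (fun z => nlGradM ρ v z) x i) volume) ∧
    Integrable (fun y =>
      ((nlDivV ρ v x - nlDivV ρ v y) * ρ (x - y) / ‖x - y‖ ^ 2) • (x - y)) volume ∧
    nlDivM ρ (fun z => isoC μ lam (symPart (nlGradM ρ v z))) x =
      (-μ) • nlLap ρ v x + (μ + lam) • nlGradS ρ (fun z => nlDivV ρ v z) x := by
  have hρ : Integrable ρ volume := by
    have := h0.2.2.1.integrableOn_isCompact hsupp
    rwa [integrableOn_iff_integrable_of_support_subset (subset_tsupport ρ)] at this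
  have hk := fun j => hasFirstMoment_gradKer hρ j
  have hvc : ∀ i, ContDiff ℝ (⊤ : ℕ∞) fun z => v z i := fun i => by fun_prop
  have hvcs : ∀ i, HasCompactSupport fun z => v z i := fun i =>
    hvs.comp_left (g := fun a : Eu n => a i) rfl
  have hvl : ∀ i, ∃ C : NNReal, LipschitzWith C fun z => v z i := fun i =>
    (hvc i).lipschitzWith_of_hasCompactSupport (hvcs i) (by simp)
  have hG : ∀ i j, ∃ C : NNReal, LipschitzWith C fun z => nlGradM ρ v z i j := fun i j => by
    simp only [nlGradM_apply]
    exact lipschitz_incrOp (hk j) (hvc i) (hvcs i)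
  have hdiv : (fun z => nlDivV ρ v z) = fun z => ∑ j, nlGradM ρ v z j j := by
    ext z
    simp only [nlDivV_eq_sum hρ hvl, nlGradM_apply]
  have htr := exists_lipschitz_sum fun k => hG k k
  have hdivl : ∃ C : NNReal, LipschitzWith C fun z => nlDivV ρ v z := hdiv ▸ htr
  have hC : ∀ i j, ∃ C : NNReal, LipschitzWith C fun z =>
      isoC μ lam (symPart (nlGradM ρ v z)) i j := fun i j => by
    simp only [isoC_symPart_apply]
    exact exists_lipschitz_add (exists_lipschitz_add (exists_lipschitz_const_mul (hG i j) μ)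
      (exists_lipschitz_const_mul (hG j i) μ)) (exists_lipschitz_const_mul htr _)
  refine ⟨fun i j => ?_, integrable_nlDivVInt hρ hvl x, integrable_nlDivMInt hρ hC x,
    integrable_nlDivMInt hρ hG x, integrable_nlGradSInt hρ hdivl x, ?_⟩
  · obtain ⟨C, hC⟩ := hvl i
    rw [nlGradMInt_eq]
    exact integrable_incr (hk j) hC x
  ext i
  have hcomm : ∀ j, incrOp (gradKer ρ j) (fun z => nlGradM ρ v z j i) x =
      incrOp (gradKer ρ i) (fun z => nlGradM ρ v z j j) x := fun j => by
    simp only [nlGradM_apply]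
    exact incrOp_comm (hk j) (hk i) (hvc j) (hvcs j) x
  have hterm : ∀ j, incrOp (gradKer ρ j)
      (fun z => isoC μ lam (symPart (nlGradM ρ v z)) i j) x =
      μ * incrOp (gradKer ρ j) (fun z => nlGradM ρ v z i j) x +
      μ * incrOp (gradKer ρ i) (fun z => nlGradM ρ v z j j) x +
      (lam * (1 : Matrix (Fin n) (Fin n) ℝ) i j) *
        incrOp (gradKer ρ j) (fun z => ∑ k, nlGradM ρ v z k k) x := fun j => by
    simp only [isoC_symPart_apply]
    obtain ⟨A, hA⟩ := exists_lipschitz_const_mul (hG i j) μ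
    obtain ⟨B, hB⟩ := exists_lipschitz_const_mul (hG j i) μ
    obtain ⟨D, hD⟩ := exists_lipschitz_const_mul htr
      (lam * (1 : Matrix (Fin n) (Fin n) ℝ) i j)
    rw [incrOp_add (hk j) (hA.add hB) hD, incrOp_add (hk j) hA hB, incrOp_const_mul,
      incrOp_const_mul, incrOp_const_mul, hcomm]
  have hdelta : ∑ j, (lam * (1 : Matrix (Fin n) (Fin n) ℝ) i j) *
      incrOp (gradKer ρ j) (fun z => ∑ k, nlGradM ρ v z k k) x =
      lam * incrOp (gradKer ρ i) (fun z => ∑ k, nlGradM ρ v z k k) x := by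
    simp [Matrix.one_apply]
  rw [PiLp.add_apply, PiLp.smul_apply, PiLp.smul_apply, nlLap, PiLp.neg_apply,
    nlDivM_apply hρ hC, nlDivM_apply hρ hG, nlGradS_apply hρ hdivl, hdiv]
  simp only [hterm, Finset.sum_add_distrib, hdelta, ← Finset.mul_sum, smul_eq_mul]
  rw [← incrOp_sum (hk i) fun j => hG j j]
  ring
end
end
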